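/- arXiv:2209.02194 — 7 statements merged into one kernel-verified Lean document; each statement's English description precedes it below -/
import Mathlib

section
/- Let Φ be a recurrent CH system on V with parameter array ({θ_i}_{i=0}^d, {θ*_i}_{i=0}^d, {φ_i}_{i=1}^d), say Φ is β-recurrent for β ∈ F. Then at least one of the following holds. (i) There exist q in the algebraic closure of F with q ≠ 0, q + q^{−1} = β, q^{d+1} = 1, q^i ≠ 1 for 1 ≤ i ≤ d, and scalars a, b, c, a*, b*, c*, y, z in the algebraic closure of F such that θ_i = a + b q^i + c q^{−i} and θ*_i = a* + b* q^i + c* q^{−i} for 0 ≤ i ≤ d, and φ_i = (q^i−1)(y − z q^{−i}) + (q^i−1)(q^{−i}−1)(b − c q^i)(b* − c* q^{−i}) for 1 ≤ i ≤ d. (ii) β = 2, char F = d+1, and there exist a, b, c, a*, b*, c*, y, z ∈ F such that θ_i = a + b i + c i(i−1)/2 and θ*_i = a* + b* i + c* i(i−1)/2 for 0 ≤ i ≤ d, and φ_i = i(y + z(i−1)/2) − i²(b + c(d−i)/2)(b* + c*(i−1)/2) for 1 ≤ i ≤ d. (iii) β = −2, d is odd, d ≥ 5, char F = (d+1)/2,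 and there exist a, b, c, a*, b*, c*, y, z ∈ F such that θ_i = a + b(−1)^i + c i(−1)^i and θ*_i = a* + b*(−1)^i + c* i(−1)^i for 0 ≤ i ≤ d, and φ_i = y((−1)^i − 1) + z i(−1)^i + (b((−1)^i−1) − c i(−1)^i)(b*((−1)^i−1) + c* i(−1)^i) for 1 ≤ i ≤ d. (iv) β = 0, d = 3, char F = 2, and there exist a, b, c, a*, b*, c*, y, z ∈ F such that θ_i = a + b i + c·C(i) and θ*_i = a* + b* i + c*·C(i) for 0 ≤ i ≤ 3, and φ_i = y i + z·C(i) + (b i + c·C(i+1))(b* i + c*·C(i)) for 1 ≤ i ≤ 3, where C(n) = 0 if n ≡ 0 or 1 (mod 4) and C(n) = 1 if n ≡ 2 or 3 (mod 4). -/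
open Polynomial Finset Module

variable {F V : Type*} [Field F] [AddCommGroup V] [Module F V]

/-- The primitive idempotent of `A` for the eigenvalue `θ i`, where the eigenvalues of `A`
are `θ 0, …, θ d`. -/
noncomputable def primIdem (d : ℕ) (A : Module.End F V) (θ : ℕ → F) (i : ℕ) :
    Module.End F V :=
  Polynomial.aeval A (∏ j ∈ (Finset.range (d+1)).erase i,
    (Polynomial.C (θ i - θ j)⁻¹ * (Polynomial.X - Polynomial.C (θ j))))

/-- A sequence `σ 0, …, σ n` is `β`-recurrent. -/
def BetaRecurrent (β : F) (n : ℕ) (σ : ℕ → F) : Prop :=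
  ∀ i, 2 ≤ i → i + 1 ≤ n → σ (i-2) - (β+1) * σ (i-1) + (β+1) * σ i - σ (i+1) = 0

/-- The scalars ϑ_i attached to eigenvalue data `θ, θs` and a split sequence `φ`:
`ϑ 0 = 0`, `ϑ (d+1) = 0` and `ϑ i = φ i - (θs i - θs 0)(θ (d-i+1) - θ 0)` for `1 ≤ i ≤ d`. -/
def vth (d : ℕ) (θ θs φ : ℕ → F) (i : ℕ) : F :=
  if 1 ≤ i ∧ i ≤ d then φ i - (θs i - θs 0) * (θ (d - i + 1) - θ 0) else 0

/-- `φ 1, …, φ d` is the split sequence for `(A, As)` with eigenvalue data `θ, θs`: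
there is a (split) basis `v 0, …, v d` of `V` on which `A, As` act in the prescribed way. -/
def SplitSeq (d : ℕ) (A As : Module.End F V) (θ θs φ : ℕ → F) : Prop :=
  ∃ v : ℕ → V,
    LinearIndependent F (fun i : Fin (d+1) => v i) ∧
    Submodule.span F (v '' Set.Iic d) = ⊤ ∧
    (∀ i < d, A (v i) = θ (d - i) • v i + v (i+1)) ∧
    A (v d) = θ 0 • v d ∧
    As (v 0) = θs 0 • v 0 ∧
    (∀ i, 1 ≤ i → i ≤ d → As (v i) = θs i • v i + φ i • v (i-1))

/-- A circular Hessenberg system on `V` of diameter `d`. -/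
structure CHSystem (F V : Type*) [Field F] [AddCommGroup V] [Module F V] (d : ℕ) where
  A : Module.End F V
  As : Module.End F V
  θ : ℕ → F
  θs : ℕ → F
  θ_inj : ∀ i ≤ d, ∀ j ≤ d, θ i = θ j → i = j
  θs_inj : ∀ i ≤ d, ∀ j ≤ d, θs i = θs j → i = j
  A_ann : Polynomial.aeval A (∏ j ∈ Finset.range (d+1), (Polynomial.X - Polynomial.C (θ j))) = 0
  As_ann : Polynomial.aeval As (∏ j ∈ Finset.range (d+1), (Polynomial.X - Polynomial.C (θs j))) = 0
  A_eig : ∀ i ≤ d, Module.End.HasEigenvalue A (θ i)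
  As_eig : ∀ i ≤ d, Module.End.HasEigenvalue As (θs i)
  circ₁ : ∀ i ≤ d, ∀ j ≤ d, ((j:ℤ) + 1 < (i:ℤ) ∨ (1 < (j:ℤ) - (i:ℤ) ∧ (j:ℤ) - (i:ℤ) < (d:ℤ))) →
      primIdem d A θ i * As * primIdem d A θ j = 0
  circ₂ : ∀ i ≤ d, ∀ j ≤ d, ((i:ℤ) = (j:ℤ) + 1 ∨ (j:ℤ) = (i:ℤ) + (d:ℤ)) →
      primIdem d A θ i * As * primIdem d A θ j ≠ 0
  circ₃ : ∀ i ≤ d, ∀ j ≤ d, ((j:ℤ) + 1 < (i:ℤ) ∨ (1 < (j:ℤ) - (i:ℤ) ∧ (j:ℤ) - (i:ℤ) < (d:ℤ))) →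
      primIdem d As θs i * A * primIdem d As θs j = 0
  circ₄ : ∀ i ≤ d, ∀ j ≤ d, ((i:ℤ) = (j:ℤ) + 1 ∨ (j:ℤ) = (i:ℤ) + (d:ℤ)) →
      primIdem d As θs i * A * primIdem d As θs j ≠ 0

/-- The function `C` used in the characteristic-two case: `C n = 0` if `n ≡ 0, 1 (mod 4)`
and `C n = 1` if `n ≡ 2, 3 (mod 4)`. -/
def Cfun (F : Type*) [Field F] (n : ℕ) : F :=
  if n % 4 = 0 ∨ n % 4 = 1 then 0 else 1

/-- Two `β`-recurrent sequences with the same first three terms agree. -/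
theorem BetaRecurrent.eq_of_eq {K : Type*} [Field K] {β : K} {n : ℕ} {σ τ : ℕ → K}
    (hσ : BetaRecurrent β n σ) (hτ : BetaRecurrent β n τ)
    (h0 : σ 0 = τ 0) (h1 : σ 1 = τ 1) (h2 : σ 2 = τ 2) : ∀ i ≤ n, σ i = τ i := by
  intro i
  induction i using Nat.strong_induction_on with
  | _ i ih =>
    intro hi
    match i, ih, hi with
    | 0, _, _ => exact h0
    | 1, _, _ => exact h1
    | 2, _, _ => exact h2
    | k + 3, ih, hi =>
      have e1 := hσ (k + 2) (by omega) hi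
      have e2 := hτ (k + 2) (by omega) hi
      have i0 := ih k (by omega) (by omega)
      have i1 := ih (k + 1) (by omega) (by omega)
      have i2 := ih (k + 2) (by omega) (by omega)
      simp only [Nat.add_sub_cancel, show k + 2 - 1 = k + 1 by omega,
        show k + 2 + 1 = k + 3 by omega] at e1 e2
      linear_combination e2 - e1 + i0 - (β + 1) * i1 + (β + 1) * i2

theorem BetaRecurrent.map {K L : Type*} [Field K] [Field L] (f : K →+* L) {β : K} {n : ℕ}
    {σ : ℕ → K} (hσ : BetaRecurrent β n σ) : BetaRecurrent (f β) n (fun i => f (σ i)) := by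
  intro i h1 h2
  have := congrArg f (hσ i h1 h2)
  simpa using this

theorem betaRecurrent_reverse {β : F} {n : ℕ} {σ : ℕ → F} (hσ : BetaRecurrent β n σ) :
    BetaRecurrent β n (fun i => σ (n - i)) := by
  intro i h1 h2
  have := hσ (n - i + 1) (by omega) (by omega)
  rw [show n - i + 1 - 2 = n - (i + 1) by omega, show n - i + 1 - 1 = n - i by omega,
    show n - i + 1 + 1 = n - (i - 2) by omega, show n - i + 1 = n - (i - 1) by omega] at this
  linear_combination -this

theorem BetaRecurrent.exists_geometric {K : Type*} [Field K] {q : K} (hq : q ≠ 0)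
    (hq2 : q ^ 2 ≠ 1) {n : ℕ} {σ : ℕ → K} (hσ : BetaRecurrent (q + q⁻¹) n σ) :
    ∃ a b c : K, ∀ i ≤ n, σ i = a + b * q ^ i + c * q⁻¹ ^ i := by
  have hm : q - 1 ≠ 0 := fun h => hq2 (by linear_combination (q + 1) * h)
  set b := (σ 2 - σ 1 - q⁻¹ * (σ 1 - σ 0)) / ((q - 1) * (q - q⁻¹)) with hb
  set c := (σ 2 - σ 1 - q * (σ 1 - σ 0)) / ((q⁻¹ - 1) * (q⁻¹ - q)) with hc
  have hqi : q - q⁻¹ ≠ 0 := by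
    intro h
    apply hq2
    field_simp at h
    linear_combination h
  have hqi' : q⁻¹ - q ≠ 0 := fun h => hqi (by linear_combination -h)
  have hmi : q⁻¹ - 1 ≠ 0 := by
    intro h
    apply hm
    field_simp at h
    linear_combination -h
  have hq' : q * q⁻¹ = 1 := mul_inv_cancel₀ hq
  have eb : b * ((q - 1) * (q - q⁻¹)) = σ 2 - σ 1 - q⁻¹ * (σ 1 - σ 0) :=
    div_mul_cancel₀ _ (mul_ne_zero hm hqi)
  have ec : c * ((q⁻¹ - 1) * (q⁻¹ - q)) = σ 2 - σ 1 - q * (σ 1 - σ 0) :=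
    div_mul_cancel₀ _ (mul_ne_zero hmi hqi')
  have e1 : σ 1 - σ 0 = b * (q - 1) + c * (q⁻¹ - 1) :=
    mul_left_cancel₀ hqi (by linear_combination ec - eb)
  have e2 : σ 2 - σ 1 = b * (q - 1) * q + c * (q⁻¹ - 1) * q⁻¹ :=
    by linear_combination q⁻¹ * e1 - eb
  clear_value b c
  refine ⟨σ 0 - b - c, b, c, hσ.eq_of_eq ?_ ?_ ?_ ?_⟩
  · intro i h1 h2
    obtain ⟨k, rfl⟩ := Nat.exists_eq_add_of_le' h1
    simp only [Nat.add_sub_cancel, show k + 2 - 1 = k + 1 by omega, pow_succ]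
    linear_combination (b * q ^ k * (q - 1) + c * q⁻¹ ^ k * (q⁻¹ - 1)) * hq'
  · ring
  · linear_combination e1
  · linear_combination e1 + e2

theorem BetaRecurrent.exists_quadratic {K : Type*} [Field K] (h2 : (2 : K) ≠ 0) {n : ℕ}
    {σ : ℕ → K} (hσ : BetaRecurrent 2 n σ) :
    ∃ a b c : K, ∀ i ≤ n, σ i = a + b * (i : K) + c * (i : K) * ((i : K) - 1) / 2 := by
  refine ⟨σ 0, σ 1 - σ 0, σ 2 - 2 * σ 1 + σ 0, hσ.eq_of_eq ?_ ?_ ?_ ?_⟩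
  · intro i h1 _
    obtain ⟨k, rfl⟩ := Nat.exists_eq_add_of_le' h1
    simp only [Nat.add_sub_cancel, show k + 2 - 1 = k + 1 by omega]
    push_cast
    field_simp
    ring
  · simp
  · simp
  · push_cast
    field_simp
    ring

theorem BetaRecurrent.exists_alternating {K : Type*} [Field K] (h2 : (2 : K) ≠ 0) {n : ℕ}
    {σ : ℕ → K} (hσ : BetaRecurrent (-2) n σ) :
    ∃ a b c : K, ∀ i ≤ n, σ i = a + b * (-1 : K) ^ i + c * (i : K) * (-1 : K) ^ i := by
  refine ⟨(σ 0 + σ 1 + (σ 2 - σ 0) / 2) / 2,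
    σ 0 - (σ 0 + σ 1 + (σ 2 - σ 0) / 2) / 2,
    (σ 2 - σ 0) / 2, hσ.eq_of_eq ?_ ?_ ?_ ?_⟩
  · intro i h1 _
    obtain ⟨k, rfl⟩ := Nat.exists_eq_add_of_le' h1
    simp only [Nat.add_sub_cancel, show k + 2 - 1 = k + 1 by omega, pow_succ]
    push_cast
    ring
  · simp
  · push_cast
    field_simp
    ring
  · push_cast
    field_simp
    ring

theorem mul_primIdem (d : ℕ) (A : Module.End F V) (θ : ℕ → F)
    (hann : Polynomial.aeval A
      (∏ j ∈ Finset.range (d + 1), (Polynomial.X - Polynomial.C (θ j))) = 0)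
    {i : ℕ} (hi : i ≤ d) : primIdem d A θ i * A = θ i • primIdem d A θ i := by
  have key : (Polynomial.X - Polynomial.C (θ i)) *
      (∏ j ∈ (Finset.range (d + 1)).erase i,
        (Polynomial.C (θ i - θ j)⁻¹ * (Polynomial.X - Polynomial.C (θ j)))) =
      (∏ j ∈ (Finset.range (d + 1)).erase i, Polynomial.C (θ i - θ j)⁻¹) *
        ∏ j ∈ Finset.range (d + 1), (Polynomial.X - Polynomial.C (θ j)) := by
    rw [← Finset.mul_prod_erase (Finset.range (d + 1))
      (fun j => Polynomial.X - Polynomial.C (θ j)) (Finset.mem_range.2 (by omega : i < d + 1)),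
      Finset.prod_mul_distrib]
    ring
  have h := congrArg (Polynomial.aeval A) ((mul_comm _ _).trans key)
  rw [map_mul, map_mul, hann, mul_zero, map_sub, Polynomial.aeval_X, Polynomial.aeval_C,
    mul_sub, sub_eq_zero, ← Algebra.commutes, ← Algebra.smul_def] at h
  exact h

theorem sum_primIdem (d : ℕ) (A : Module.End F V) (θ : ℕ → F)
    (hinj : ∀ i ≤ d, ∀ j ≤ d, θ i = θ j → i = j) :
    ∑ i ∈ Finset.range (d + 1), primIdem d A θ i = 1 := by
  have h := Lagrange.sum_basis (s := Finset.range (d + 1)) (v := θ)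
    (fun i hi j hj hij => hinj i (by simp at hi; omega) j (by simp at hj; omega) hij) (by simp)
  have h' := congrArg (Polynomial.aeval A) h
  rw [map_sum, map_one] at h'
  exact h'

/-- The recurrence satisfied by the values on the split basis of a functional on which `A` acts
from the right as a scalar. -/
theorem eigenfunctional_apply_succ {d : ℕ} {A : Module.End F V} {θ : ℕ → F} {v : ℕ → V}
    (hA : ∀ i < d, A (v i) = θ (d - i) • v i + v (i + 1)) {f : V →ₗ[F] F} {t : F}
    (hf : ∀ x, f (A x) = t * f x) {h : ℕ} (hh : h < d) :
    f (v (h + 1)) = (t - θ (d - h)) * f (v h) := by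
  have := hf (v h)
  rw [hA h hh, map_add, map_smul, smul_eq_mul] at this
  linear_combination this

/-- The first integrals of a `β`-recurrent sequence. -/
theorem BetaRecurrent.exists_first_integrals {β : F} {d : ℕ} {θ : ℕ → F}
    (hθ : BetaRecurrent β d θ) :
    ∃ γ ρ : F, (∀ i, i + 2 ≤ d → θ i - β * θ (i + 1) + θ (i + 2) = γ) ∧
      ∀ i, i + 1 ≤ d → θ i ^ 2 - β * θ i * θ (i + 1) + θ (i + 1) ^ 2
        - γ * (θ i + θ (i + 1)) = ρ := by
  have h1 : ∀ i, i + 2 ≤ d → θ i - β * θ (i + 1) + θ (i + 2) = θ 0 - β * θ 1 + θ 2 := by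
    intro i
    induction i with
    | zero => intro _; rfl
    | succ k ih =>
      intro hk
      have e := hθ (k + 2) (by omega) (by omega)
      have i0 := ih (by omega)
      simp only [Nat.add_sub_cancel, show k + 2 - 1 = k + 1 by omega] at e
      rw [show k + 1 + 1 = k + 2 by omega, show k + 1 + 2 = k + 2 + 1 by omega]
      linear_combination i0 - e
  refine ⟨θ 0 - β * θ 1 + θ 2, θ 0 ^ 2 - β * θ 0 * θ 1 + θ 1 ^ 2
    - (θ 0 - β * θ 1 + θ 2) * (θ 0 + θ 1), h1, fun i => ?_⟩
  induction i with
  | zero => intro _; rfl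
  | succ k ih =>
    intro hk
    have e := h1 k (by omega)
    have i0 := ih (by omega)
    rw [show k + 1 + 1 = k + 2 by omega]
    linear_combination i0 + (θ (k + 2) - θ k) * e

/-- The eigenvalue sequence of a recurrent circular Hessenberg system is cyclically
`β`-recurrent. -/
theorem betaRecurrent_cyclic {d : ℕ} (hd : 3 ≤ d) {A As : Module.End F V} {θ θs φ : ℕ → F}
    (hinj : ∀ i ≤ d, ∀ j ≤ d, θ i = θ j → i = j)
    (hann : Polynomial.aeval A
      (∏ j ∈ Finset.range (d + 1), (Polynomial.X - Polynomial.C (θ j))) = 0)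
    (hz : ∀ j, 1 < j → j < d → primIdem d A θ 0 * As * primIdem d A θ j = 0)
    (hnz : primIdem d A θ 0 * As * primIdem d A θ d ≠ 0)
    {v : ℕ → V} (hspan : Submodule.span F (v '' Set.Iic d) = ⊤)
    (hA : ∀ i < d, A (v i) = θ (d - i) • v i + v (i + 1)) (hAs0 : As (v 0) = θs 0 • v 0)
    (hAs : ∀ i, 1 ≤ i → i ≤ d → As (v i) = θs i • v i + φ i • v (i - 1))
    {β : F} (hθ : BetaRecurrent β d θ)
    (hϑ : BetaRecurrent β (d + 1) (vth d θ θs φ)) :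
    BetaRecurrent β (d + 2) (fun i => θ (i % (d + 1))) := by
  obtain ⟨x, hx⟩ : ∃ x, (primIdem d A θ 0 * As * primIdem d A θ d) x ≠ 0 := by
    by_contra! h
    exact hnz (LinearMap.ext h)
  obtain ⟨l, hl⟩ : ∃ l : Module.Dual F V,
      l ((primIdem d A θ 0 * As * primIdem d A θ d) x) ≠ 0 := by
    by_contra! h
    exact hx ((Module.forall_dual_apply_eq_zero_iff F _).1 h)
  set f : Module.Dual F V := l ∘ₗ primIdem d A θ 0 with hf
  set g : ℕ → Module.Dual F V := fun j => f ∘ₗ As ∘ₗ primIdem d A θ j with hg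
  have hidem : ∀ j ≤ d, ∀ x, primIdem d A θ j (A x) = θ j • primIdem d A θ j x := by
    intro j hj x
    exact LinearMap.congr_fun (mul_primIdem d A θ hann hj) x
  have hfA : ∀ x, f (A x) = θ 0 * f x := by
    intro x
    simp [hf, hidem 0 (by omega) x]
  have hgA : ∀ j ≤ d, ∀ x, g j (A x) = θ j * g j x := by
    intro j hj x
    simp [hg, hidem j hj x]
  have hgz : ∀ j, 1 < j → j < d → ∀ x, g j x = 0 := by
    intro j h1 h2 x
    have := LinearMap.congr_fun (hz j h1 h2) x
    simp only [Module.End.mul_apply, LinearMap.zero_apply] at this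
    simp [hg, hf, this]
  have hsum : ∀ x, f (As x) = g 0 x + g 1 x + g d x := by
    intro x
    have h1 := LinearMap.congr_fun (sum_primIdem d A θ hinj) x
    rw [LinearMap.sum_apply, Module.End.one_apply] at h1
    have h2 : f (As x) = ∑ j ∈ Finset.range (d + 1), g j x := by
      conv_lhs => rw [← h1]
      simp [hg]
    obtain ⟨e, rfl⟩ : ∃ e, d = e + 2 := ⟨d - 2, by omega⟩
    rw [h2, Finset.sum_range_succ, Finset.sum_range_succ', Finset.sum_range_succ']
    rw [Finset.sum_eq_zero]
    · ring
    · intro j hj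
      exact hgz _ (by omega) (by simp at hj; omega) x
  have hgd : g d (v 0) ≠ 0 := by
    intro h0
    have hall : ∀ i ≤ d, g d (v i) = 0 := by
      intro i
      induction i with
      | zero => intro _; exact h0
      | succ k ih =>
        intro hk
        rw [eigenfunctional_apply_succ hA (hgA d le_rfl) (by omega), ih (by omega), mul_zero]
    apply hl
    have hz : g d = 0 := by
      apply LinearMap.ext_on hspan
      rintro _ ⟨i, hi, rfl⟩
      exact hall i hi
    exact LinearMap.congr_fun hz x
  have hf1 := eigenfunctional_apply_succ hA hfA (h := 0) (by omega)
  have hf2 := eigenfunctional_apply_succ hA hfA (h := 1) (by omega)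
  have hf3 := eigenfunctional_apply_succ hA hfA (h := 2) (by omega)
  have ha1 := eigenfunctional_apply_succ hA (hgA 0 (by omega)) (h := 0) (by omega)
  have ha2 := eigenfunctional_apply_succ hA (hgA 0 (by omega)) (h := 1) (by omega)
  have ha3 := eigenfunctional_apply_succ hA (hgA 0 (by omega)) (h := 2) (by omega)
  have hb1 := eigenfunctional_apply_succ hA (hgA 1 (by omega)) (h := 0) (by omega)
  have hb2 := eigenfunctional_apply_succ hA (hgA 1 (by omega)) (h := 1) (by omega)
  have hb3 := eigenfunctional_apply_succ hA (hgA 1 (by omega)) (h := 2) (by omega)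
  have hc1 := eigenfunctional_apply_succ hA (hgA d le_rfl) (h := 0) (by omega)
  have hc2 := eigenfunctional_apply_succ hA (hgA d le_rfl) (h := 1) (by omega)
  have hc3 := eigenfunctional_apply_succ hA (hgA d le_rfl) (h := 2) (by omega)
  simp only [Nat.zero_add, Nat.sub_zero, Nat.reduceAdd] at hf1 hf2 hf3 ha1 ha2 ha3
  simp only [Nat.zero_add, Nat.sub_zero, Nat.reduceAdd] at hb1 hb2 hb3 hc1 hc2 hc3
  rw [sub_self, zero_mul] at hc1
  rw [hc1, mul_zero] at hc2
  rw [hc2, mul_zero] at hc3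
  have s0 := hsum (v 0)
  have s1 := hsum (v 1)
  have s2 := hsum (v 2)
  have s3 := hsum (v 3)
  rw [hAs0, map_smul, smul_eq_mul] at s0
  rw [hAs 1 le_rfl (by omega), map_add, map_smul, map_smul, smul_eq_mul, smul_eq_mul,
    ha1, hb1, hc1, hf1, Nat.sub_self] at s1
  rw [hAs 2 (by omega) (by omega), map_add, map_smul, map_smul, smul_eq_mul, smul_eq_mul,
    ha2, hb2, hc2, hf2, show 2 - 1 = 1 from rfl, ha1, hb1, hf1] at s2
  rw [hAs 3 (by omega) (by omega), map_add, map_smul, map_smul, smul_eq_mul, smul_eq_mul,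
    ha3, hb3, hc3, hf3, show 3 - 1 = 2 from rfl, ha2, hb2, hf2, ha1, hb1, hf1] at s3
  have hr := hϑ 2 le_rfl (by omega)
  simp only [vth, Nat.sub_self, show 2 - 1 = 1 from rfl, show 2 + 1 = 3 from rfl,
    show d - 1 + 1 = d by omega, show d - 2 + 1 = d - 1 by omega,
    show d - 3 + 1 = d - 2 by omega] at hr
  rw [if_neg (by omega), if_pos (by omega), if_pos (by omega), if_pos (by omega)] at hr
  obtain ⟨γ, ρ, hγ, hρ⟩ := hθ.exists_first_integrals
  have r0 := hρ 0 (by omega)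
  have r1 := hρ (d - 1) (by omega)
  have r2 := hγ (d - 2) (by omega)
  rw [show d - 2 + 1 = d - 1 by omega, show d - 2 + 2 = d by omega] at r2
  rw [show d - 1 + 1 = d by omega] at r1
  rw [Nat.zero_add] at r0
  have n1 : θ 0 - θ d ≠ 0 := fun h => by
    have := hinj 0 (by omega) d le_rfl (sub_eq_zero.1 h); omega
  have n2 : θ 0 - θ (d - 1) ≠ 0 := fun h => by
    have := hinj 0 (by omega) (d - 1) (by omega) (sub_eq_zero.1 h); omega
  have n3 : θ d - θ 1 ≠ 0 := fun h => by
    have := hinj d le_rfl 1 (by omega) (sub_eq_zero.1 h); omega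
  have hp : θ (d - 2) = β * θ (d - 1) - θ d + γ := by linear_combination r2
  rw [hp] at s3 hr
  have hX : (g d (v 0) * (θ 0 - θ d) * (θ 0 - θ (d - 1))) *
      (γ - θ (d - 1) + β * θ d - θ 0) = 0 := by
    linear_combination
      -(γ - θ (d - 1) + β * θ d - θ 0) * (θ 0 - θ d) * (θ 0 - θ (d - 1)) * s0
      - (β + 1) * (θ 0 - θ d) * (θ 0 - θ (d - 1)) * s1
      + (β + 1) * (θ 0 - θ (d - 1)) * s2 - s3
      - f (v 0) * (θ 0 - θ d) * (θ 0 - θ (d - 1)) * hr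
      + g 1 (v 0) * (θ 0 - θ 1) * (r0 - r1)
  have hX' := (mul_eq_zero.1 hX).resolve_left (mul_ne_zero (mul_ne_zero hgd n1) n2)
  have hY : θ d + θ 1 - β * θ 0 - γ = 0 := by
    apply mul_left_cancel₀ n3
    linear_combination r1 - r0 - (θ 0 - θ (d - 1)) * hX'
  intro i h1 h2
  rcases Nat.lt_or_ge i d with h | h
  · have := hθ i h1 (by omega)
    simpa only [Nat.mod_eq_of_lt (show i - 2 < d + 1 by omega),
      Nat.mod_eq_of_lt (show i - 1 < d + 1 by omega), Nat.mod_eq_of_lt (show i < d + 1 by omega),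
      Nat.mod_eq_of_lt (show i + 1 < d + 1 by omega)] using this
  obtain rfl | rfl : i = d ∨ i = d + 1 := by omega
  · simp only [Nat.mod_eq_of_lt (show i - 2 < i + 1 by omega),
      Nat.mod_eq_of_lt (show i - 1 < i + 1 by omega), Nat.mod_eq_of_lt (show i < i + 1 by omega),
      Nat.mod_self]
    linear_combination r2 + hX'
  · simp only [show d + 1 - 2 = d - 1 by omega, Nat.add_sub_cancel,
      Nat.mod_eq_of_lt (show d - 1 < d + 1 by omega), Nat.mod_eq_of_lt (show d < d + 1 by omega),
      Nat.mod_self, Nat.add_mod_left, Nat.mod_eq_of_lt (show 1 < d + 1 by omega)]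
    linear_combination -hX' - hY

/-- A cyclic extension of a sequence to period `d + 1`, evaluated up to `d + 2`. -/
theorem cyclic_eval {K : Type*} {d : ℕ} (hd : 1 ≤ d) {θ τ : ℕ → K}
    (h : ∀ i ≤ d + 2, θ (i % (d + 1)) = τ i) :
    (∀ i ≤ d, θ i = τ i) ∧ τ (d + 1) = τ 0 ∧ τ (d + 2) = τ 1 := by
  have h0 : ∀ i ≤ d, θ i = τ i := fun i hi => by
    have := h i (by omega)
    rwa [Nat.mod_eq_of_lt (by omega)] at this
  refine ⟨h0, ?_, ?_⟩
  · rw [← h (d + 1) (by omega), Nat.mod_self, h0 0 (by omega)]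
  · rw [← h (d + 2) (by omega), show d + 2 = (d + 1) + 1 by omega, Nat.add_mod_left,
      Nat.mod_eq_of_lt (by omega), h0 1 hd]

theorem geometric_of_cyclic {K : Type*} [Field K] {q : K} (hq : q ≠ 0) (hq2 : q ^ 2 ≠ 1)
    {d : ℕ} (hd : 3 ≤ d) {θ : ℕ → K} (hinj : ∀ i ≤ d, ∀ j ≤ d, θ i = θ j → i = j)
    (hθ : BetaRecurrent (q + q⁻¹) (d + 2) (fun i => θ (i % (d + 1)))) :
    q ^ (d + 1) = 1 ∧ (∀ i, 1 ≤ i → i ≤ d → q ^ i ≠ 1) ∧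
      ∃ a b c : K, ∀ i ≤ d, θ i = a + b * q ^ i + c * q⁻¹ ^ i := by
  obtain ⟨a, b, c, h⟩ := hθ.exists_geometric hq hq2
  obtain ⟨h0, h1, h2⟩ := cyclic_eval (by omega) h
  have hpq : q - q⁻¹ ≠ 0 := by
    intro h
    apply hq2
    field_simp at h
    linear_combination h
  refine ⟨?_, ?_, a, b, c, h0⟩
  · by_contra hQ
    have hP : q⁻¹ ^ (d + 1) ≠ 1 := by rwa [inv_pow, ne_eq, inv_eq_one]
    rw [show d + 2 = d + 1 + 1 by omega, pow_succ q (d + 1), pow_succ q⁻¹ (d + 1)] at h2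
    have hb : b = 0 := by
      have : b * ((q ^ (d + 1) - 1) * (q - q⁻¹)) = 0 := by
        linear_combination h2 - q⁻¹ * h1
      exact (mul_eq_zero.1 this).resolve_right (mul_ne_zero (sub_ne_zero.2 hQ) hpq)
    have hc : c = 0 := by
      have : c * ((q⁻¹ ^ (d + 1) - 1) * (q - q⁻¹)) = 0 := by
        linear_combination q * h1 - h2
      exact (mul_eq_zero.1 this).resolve_right (mul_ne_zero (sub_ne_zero.2 hP) hpq)
    have := hinj 0 (by omega) 1 (by omega) (by rw [h0 0 (by omega), h0 1 (by omega), hb, hc]; ring)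
    omega
  · intro i hi hid hqi
    have := hinj i hid 0 (by omega) (by
      rw [h0 i hid, h0 0 (by omega), inv_pow, hqi]; simp)
    omega

theorem quadratic_of_cyclic {K : Type*} [Field K] (h2 : (2 : K) ≠ 0)
    {d : ℕ} (hd : 3 ≤ d) {θ : ℕ → K} (hinj : ∀ i ≤ d, ∀ j ≤ d, θ i = θ j → i = j)
    (hθ : BetaRecurrent 2 (d + 2) (fun i => θ (i % (d + 1)))) :
    ringChar K = d + 1 ∧
      ∃ a b c : K, ∀ i ≤ d, θ i = a + b * (i : K) + c * (i : K) * ((i : K) - 1) / 2 := by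
  obtain ⟨a, b, c, h⟩ := hθ.exists_quadratic h2
  obtain ⟨h0, e1, e2⟩ := cyclic_eval (by omega) h
  refine ⟨?_, a, b, c, h0⟩
  push_cast at e1 e2
  field_simp at e1 e2
  have hN : ((d + 1 : ℕ) : K) = 0 := by
    by_contra hN
    push_cast at hN
    have hc : c = 0 := by
      have : c * ((d + 1) * 2) = 0 := by linear_combination e2 - e1
      exact (mul_eq_zero.1 this).resolve_right (mul_ne_zero hN h2)
    have hb : b = 0 := by
      have : b * ((d + 1) * 2) = 0 := by
        rw [hc] at e1
        linear_combination e1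
      exact (mul_eq_zero.1 this).resolve_right (mul_ne_zero hN h2)
    have := hinj 0 (by omega) 1 (by omega) (by rw [h0 0 (by omega), h0 1 (by omega), hb, hc]; ring)
    omega
  have hdvd := (ringChar.spec K (d + 1)).1 hN
  have hle := Nat.le_of_dvd (by omega) hdvd
  by_contra hne
  have := hinj (ringChar K) (by omega) 0 (by omega) (by
    rw [h0 _ (by omega), h0 0 (by omega), ringChar.Nat.cast_ringChar]; simp)
  rw [this, zero_dvd_iff] at hdvd
  omega

theorem alternating_of_cyclic {K : Type*} [Field K] (h2 : (2 : K) ≠ 0)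
    {d : ℕ} (hd : 3 ≤ d) {θ : ℕ → K} (hinj : ∀ i ≤ d, ∀ j ≤ d, θ i = θ j → i = j)
    (hθ : BetaRecurrent (-2) (d + 2) (fun i => θ (i % (d + 1)))) :
    Odd d ∧ 5 ≤ d ∧ ringChar K = (d + 1) / 2 ∧ ((d + 1 : ℕ) : K) = 0 ∧
      ∃ a b c : K, ∀ i ≤ d, θ i = a + b * (-1 : K) ^ i + c * (i : K) * (-1 : K) ^ i := by
  obtain ⟨a, b, c, h⟩ := hθ.exists_alternating h2
  obtain ⟨h0, e1, e2⟩ := cyclic_eval (by omega) h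
  rw [show d + 2 = d + 1 + 1 by omega, pow_succ _ (d + 1)] at e2
  push_cast at e1 e2
  have hodd : Odd d := by
    by_contra hev
    rw [Nat.not_odd_iff_even] at hev
    rw [hev.add_one.neg_one_pow] at e1 e2
    have hc : c = 0 := by
      have : c * 2 = 0 := by linear_combination e1 + e2
      exact (mul_eq_zero.1 this).resolve_right h2
    have hb : b = 0 := by
      have : b * 2 = 0 := by
        rw [hc] at e1
        linear_combination -e1
      exact (mul_eq_zero.1 this).resolve_right h2
    have := hinj 0 (by omega) 1 (by omega) (by rw [h0 0 (by omega), h0 1 (by omega), hb, hc]; ring)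
    omega
  rw [hodd.add_one.neg_one_pow] at e1 e2
  have hN : ((d + 1 : ℕ) : K) = 0 := by
    by_contra hN
    push_cast at hN
    have hc : c = 0 := by
      have : c * (d + 1) = 0 := by linear_combination e1
      exact (mul_eq_zero.1 this).resolve_right hN
    have := hinj 0 (by omega) 2 (by omega) (by rw [h0 0 (by omega), h0 2 (by omega), hc]; ring)
    omega
  have hdvd := (ringChar.spec K (d + 1)).1 hN
  have hp2 : ¬ ringChar K ∣ 2 := fun h => h2 (by exact_mod_cast (ringChar.spec K 2).2 h)
  have hp0 : ringChar K ≠ 0 := by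
    intro h
    rw [h, zero_dvd_iff] at hdvd
    omega
  have hp : (ringChar K).Prime :=
    (CharP.char_is_prime_or_zero K (ringChar K)).resolve_right hp0
  have hcop : Nat.Coprime 2 (ringChar K) :=
    (Nat.coprime_primes Nat.prime_two hp).2 (fun h => hp2 h.symm.dvd)
  have h2p := Nat.le_of_dvd (by omega)
    (hcop.mul_dvd_of_dvd_of_dvd (even_iff_two_dvd.1 hodd.add_one) hdvd)
  have hge : d + 1 ≤ 2 * ringChar K := by
    by_contra hlt
    have := hinj (2 * ringChar K) (by omega) 0 (by omega) (by
      rw [h0 _ (by omega), h0 0 (by omega), Nat.cast_mul, ringChar.Nat.cast_ringChar, pow_mul]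
      simp)
    omega
  have h3 : 3 ≤ ringChar K := by
    have := hp.two_le
    rcases Nat.lt_or_ge (ringChar K) 3 with h | h
    · exact absurd (by rw [show ringChar K = 2 by omega]) hp2
    · exact h
  exact ⟨hodd, by omega, by omega, hN, a, b, c, h0⟩

theorem eq_three_of_zero_recurrent {K : Type*} [Field K] {d : ℕ} (hd : 3 ≤ d) {θ : ℕ → K}
    (hinj : ∀ i ≤ d, ∀ j ≤ d, θ i = θ j → i = j)
    (hθ : BetaRecurrent 0 d θ) : d = 3 := by
  by_contra hne
  have e1 := hθ 2 le_rfl (by omega)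
  have e2 := hθ 3 (by omega) (by omega)
  norm_num at e1 e2
  have := hinj 0 (by omega) 4 (by omega) (by
    linear_combination e1 + e2 )
  omega

/-- The reversed, rescaled split basis exchanging the roles of the two maps. -/
theorem exists_dual_split {d : ℕ} {A As : Module.End F V} {θ θs φ : ℕ → F}
    (hφ0 : ∀ i, 1 ≤ i → i ≤ d → φ i ≠ 0) (hsplit : SplitSeq d A As θ θs φ) :
    ∃ v : ℕ → V, Submodule.span F (v '' Set.Iic d) = ⊤ ∧
      (∀ i < d, As (v i) = θs (d - i) • v i + v (i + 1)) ∧ A (v 0) = θ 0 • v 0 ∧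
      (∀ i, 1 ≤ i → i ≤ d → A (v i) = θ i • v i + φ (d + 1 - i) • v (i - 1)) := by
  obtain ⟨v, -, hspan, hA, hAd, -, hAs⟩ := hsplit
  refine ⟨fun i => (∏ k ∈ Finset.range i, φ (d - k)) • v (d - i), ?_, ?_, ?_, ?_⟩
  · rw [eq_top_iff, ← hspan, Submodule.span_le]
    rintro _ ⟨i, hi, rfl⟩
    rw [Set.mem_Iic] at hi
    have hne : ∏ k ∈ Finset.range (d - i), φ (d - k) ≠ 0 :=
      Finset.prod_ne_zero_iff.2 fun k hk => by
        rw [Finset.mem_range] at hk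
        exact hφ0 _ (by omega) (by omega)
    rw [SetLike.mem_coe, ← Submodule.smul_mem_iff _ hne]
    apply Submodule.subset_span
    exact ⟨d - i, Set.mem_Iic.2 (by omega), by simp [show d - (d - i) = i by omega]⟩
  · intro i hi
    simp only [map_smul, hAs (d - i) (by omega) (by omega), Finset.prod_range_succ, smul_add,
      smul_smul, show d - i - 1 = d - (i + 1) by omega]
    rw [mul_comm (θs (d - i))]
  · simp [hAd]
  · intro i h1 h2
    obtain ⟨k, rfl⟩ := Nat.exists_eq_add_of_le' h1
    simp only [map_smul, hA (d - (k + 1)) (by omega), Finset.prod_range_succ, smul_add,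
      smul_smul, show d - (d - (k + 1)) = k + 1 by omega, show d - (k + 1) + 1 = d - k by omega,
      Nat.add_sub_cancel, show d + 1 - (k + 1) = d - k by omega]
    congr 2 <;> ring

theorem vth_dual {d : ℕ} (θ θs φ : ℕ → F) :
    vth d θs θ (fun i => φ (d + 1 - i)) = fun i => vth d θ θs φ (d + 1 - i) := by
  funext i
  unfold vth
  by_cases h : 1 ≤ i ∧ i ≤ d
  · rw [if_pos h, if_pos (by omega), show d - (d + 1 - i) + 1 = i by omega,
      show d - i + 1 = d + 1 - i by omega]
    ring
  · rw [if_neg h, if_neg (by omega)]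

/-- every recurrent CH system has its parameter array in one of the
four families. -/
theorem stmt1 {F V : Type*} [Field F] [AddCommGroup V] [Module F V]
    (d : ℕ) (hd : 3 ≤ d) (hdim : Module.finrank F V = d + 1)
    (Φ : CHSystem F V d) (φ : ℕ → F)
    (hφ0 : ∀ i, 1 ≤ i → i ≤ d → φ i ≠ 0)
    (hsplit : SplitSeq d Φ.A Φ.As Φ.θ Φ.θs φ)
    (β : F)
    (hrec : BetaRecurrent β d Φ.θ ∧ BetaRecurrent β d Φ.θs ∧
      BetaRecurrent β (d+1) (vth d Φ.θ Φ.θs φ)) :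
    -- (i) the `q`-case
    (∃ q a b c as bs cs y z : AlgebraicClosure F,
      q ≠ 0 ∧
      q + q⁻¹ = algebraMap F (AlgebraicClosure F) β ∧
      q^(d+1) = 1 ∧
      (∀ i, 1 ≤ i → i ≤ d → q^i ≠ 1) ∧
      (∀ i ≤ d, algebraMap F (AlgebraicClosure F) (Φ.θ i) = a + b * q^i + c * q⁻¹^i) ∧
      (∀ i ≤ d, algebraMap F (AlgebraicClosure F) (Φ.θs i) = as + bs * q^i + cs * q⁻¹^i) ∧
      (∀ i, 1 ≤ i → i ≤ d →
        algebraMap F (AlgebraicClosure F) (φ i) =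
          (q^i - 1) * (y - z * q⁻¹^i)
          + (q^i - 1) * (q⁻¹^i - 1) * (b - c * q^i) * (bs - cs * q⁻¹^i))) ∨
    -- (ii) β = 2, char F = d+1
    (β = 2 ∧ ringChar F = d + 1 ∧
      ∃ a b c as bs cs y z : F,
        (∀ i ≤ d, Φ.θ i = a + b * (i : F) + c * (i : F) * ((i : F) - 1) / 2) ∧
        (∀ i ≤ d, Φ.θs i = as + bs * (i : F) + cs * (i : F) * ((i : F) - 1) / 2) ∧
        (∀ i, 1 ≤ i → i ≤ d →
          φ i = (i : F) * (y + z * ((i : F) - 1) / 2)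
            - (i : F)^2 * (b + c * ((d : F) - (i : F)) / 2)
              * (bs + cs * ((i : F) - 1) / 2))) ∨
    -- (iii) β = -2, d odd, d ≥ 5, char F = (d+1)/2
    (β = -2 ∧ Odd d ∧ 5 ≤ d ∧ ringChar F = (d + 1) / 2 ∧
      ∃ a b c as bs cs y z : F,
        (∀ i ≤ d, Φ.θ i = a + b * (-1 : F)^i + c * (i : F) * (-1 : F)^i) ∧
        (∀ i ≤ d, Φ.θs i = as + bs * (-1 : F)^i + cs * (i : F) * (-1 : F)^i) ∧
        (∀ i, 1 ≤ i → i ≤ d →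
          φ i = y * ((-1 : F)^i - 1) + z * (i : F) * (-1 : F)^i
            + (b * ((-1 : F)^i - 1) - c * (i : F) * (-1 : F)^i)
              * (bs * ((-1 : F)^i - 1) + cs * (i : F) * (-1 : F)^i))) ∨
    -- (iv) β = 0, d = 3, char F = 2
    (β = 0 ∧ d = 3 ∧ ringChar F = 2 ∧
      ∃ a b c as bs cs y z : F,
        (∀ i ≤ 3, Φ.θ i = a + b * (i : F) + c * Cfun F i) ∧
        (∀ i ≤ 3, Φ.θs i = as + bs * (i : F) + cs * Cfun F i) ∧
        (∀ i, 1 ≤ i → i ≤ 3 →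
          φ i = y * (i : F) + z * Cfun F i
            + (b * (i : F) + c * Cfun F (i+1)) * (bs * (i : F) + cs * Cfun F i))) := by
  obtain ⟨hθ, hθs, hϑ⟩ := hrec
  have hc : BetaRecurrent β (d + 2) (fun i => Φ.θ (i % (d + 1))) := by
    obtain ⟨v, -, hspan, hA, -, hAs0, hAs⟩ := hsplit
    exact betaRecurrent_cyclic hd Φ.θ_inj Φ.A_ann
      (fun j h1 h2 => Φ.circ₁ 0 (by omega) j (by omega) (by omega))
      (Φ.circ₂ 0 (by omega) d le_rfl (by omega)) hspan hA hAs0 hAs hθ hϑ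
  have hcs : BetaRecurrent β (d + 2) (fun i => Φ.θs (i % (d + 1))) := by
    obtain ⟨v, hspan, hA, hAs0, hAs⟩ := exists_dual_split hφ0 hsplit
    refine betaRecurrent_cyclic (φ := fun i => φ (d + 1 - i)) hd Φ.θs_inj Φ.As_ann
      (fun j h1 h2 => Φ.circ₃ 0 (by omega) j (by omega) (by omega))
      (Φ.circ₄ 0 (by omega) d le_rfl (by omega)) hspan hA hAs0 hAs hθs ?_
    rw [vth_dual]
    exact betaRecurrent_reverse hϑ
  have hφ : ∀ i, 1 ≤ i → i ≤ d →
      φ i = vth d Φ.θ Φ.θs φ i + (Φ.θs i - Φ.θs 0) * (Φ.θ (d - i + 1) - Φ.θ 0) := by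
    intro i h1 h2
    rw [vth, if_pos ⟨h1, h2⟩]
    ring
  have hv0 : vth d Φ.θ Φ.θs φ 0 = 0 := by simp [vth]
  generalize vth d Φ.θ Φ.θs φ = ϑ at hϑ hφ hv0
  by_cases hβ : β = 2 ∨ β = -2
  · right
    by_cases h2 : (2 : F) = 0
    · right; right
      have hβ0 : β = 0 := by
        rcases hβ with h | h <;> simp [h, h2]
      subst hβ0
      obtain rfl := eq_three_of_zero_recurrent hd Φ.θ_inj hθ
      have hp : ringChar F = 2 := by
        have hdvd := (ringChar.spec F 2).1 (by exact_mod_cast h2)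
        exact (Nat.prime_two.eq_one_or_self_of_dvd _ hdvd).resolve_left CharP.ringChar_ne_one
      have e1 := hθ 2 le_rfl le_rfl
      have e2 := hθs 2 le_rfl le_rfl
      have e3 := hϑ 2 le_rfl (by omega)
      norm_num at e1 e2 e3
      refine ⟨rfl, rfl, hp, Φ.θ 0, Φ.θ 1 - Φ.θ 0, Φ.θ 2 - Φ.θ 0, Φ.θs 0, Φ.θs 1 - Φ.θs 0,
        Φ.θs 2 - Φ.θs 0, ϑ 1, ϑ 2, ?_, ?_, ?_⟩
      · intro i hi
        interval_cases i <;> simp [Cfun]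
        · linear_combination -(Φ.θ 1 - Φ.θ 0) * h2
        · linear_combination -e1 + 2 * (Φ.θ 0 - Φ.θ 1) * h2
      · intro i hi
        interval_cases i <;> simp [Cfun]
        · linear_combination -(Φ.θs 1 - Φ.θs 0) * h2
        · linear_combination -e2 + 2 * (Φ.θs 0 - Φ.θs 1) * h2
      · intro i h1 h3
        have c1 : Cfun F 1 = 0 := by simp [Cfun]
        have c2 : Cfun F 2 = 1 := by simp [Cfun]
        have c3 : Cfun F 3 = 1 := by simp [Cfun]
        have c4 : Cfun F 4 = 0 := by simp [Cfun]
        rw [hφ i h1 h3]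
        interval_cases i <;> simp only [Nat.reduceAdd, Nat.reduceSub, c1, c2, c3, c4] <;> push_cast
        · linear_combination (Φ.θs 1 - Φ.θs 0) * (-e1 + (Φ.θ 0 - Φ.θ 1) * h2)
        · linear_combination -(ϑ 1 + (Φ.θ 1 - Φ.θ 0) * ((Φ.θs 1 - Φ.θs 0) * 2
            + (Φ.θs 2 - Φ.θs 0)) + (Φ.θ 2 - Φ.θ 0) * (Φ.θs 1 - Φ.θs 0)) * h2
        · linear_combination -e3 + hv0 - 2 * ϑ 1 * h2 + (Φ.θ 1 - Φ.θ 0) *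
            (-e2 + (6 * Φ.θs 0 - 5 * Φ.θs 1 - Φ.θs 2) * h2)
    · rcases hβ with rfl | rfl
      · left
        obtain ⟨hp, a, b, c, h⟩ := quadratic_of_cyclic h2 hd Φ.θ_inj hc
        obtain ⟨-, as, bs, cs, hs⟩ := quadratic_of_cyclic h2 hd Φ.θs_inj hcs
        obtain ⟨x, y, z, hv⟩ := hϑ.exists_quadratic h2
        refine ⟨rfl, hp, a, b, c, as, bs, cs, y, z, h, hs, fun i h1 h3 => ?_⟩
        have hN : (d : F) + 1 = 0 := by
          have := ringChar.Nat.cast_ringChar (R := F)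
          rw [hp] at this
          exact_mod_cast this
        have hx := hv 0 (by omega)
        rw [hv0] at hx
        rw [hφ i h1 h3, hv i (by omega), hs i h3, hs 0 (by omega), h _ (by omega),
          h 0 (by omega)]
        push_cast [Nat.cast_sub h3] at hx ⊢
        rw [show (d : F) = -1 by linear_combination hN]
        field_simp
        linear_combination -4 * hx
      · right; left
        obtain ⟨hodd, h5, hp, hN, a, b, c, h⟩ := alternating_of_cyclic h2 hd Φ.θ_inj hc
        obtain ⟨-, -, -, -, as, bs, cs, hs⟩ := alternating_of_cyclic h2 hd Φ.θs_inj hcs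
        obtain ⟨x, y, z, hv⟩ := hϑ.exists_alternating h2
        refine ⟨rfl, hodd, h5, hp, a, b, c, as, bs, cs, y, z, h, hs, fun i h1 h3 => ?_⟩
        have hx := hv 0 (by omega)
        have hsgn : (-1 : F) ^ (d - i + 1) = (-1) ^ i := by
          apply neg_one_pow_congr
          have := hodd.add_one
          rw [show d + 1 = d - i + 1 + i by omega, Nat.even_add] at this
          exact this
        have hcast : ((d - i + 1 : ℕ) : F) = -i := by
          rw [eq_neg_iff_add_eq_zero, ← Nat.cast_add, show d - i + 1 + i = d + 1 by omega, hN]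
        rw [hφ i h1 h3, hv i (by omega), hs i h3, hs 0 (by omega), h _ (by omega),
          h 0 (by omega), hsgn, hcast]
        rw [hv0] at hx
        push_cast at hx ⊢
        linear_combination -hx
  · left
    rw [not_or] at hβ
    set f := algebraMap F (AlgebraicClosure F) with hf
    obtain ⟨q, hroot⟩ := IsAlgClosed.exists_root
      (X ^ 2 - C (f β) * X + 1 : (AlgebraicClosure F)[X]) (by
        have : (X ^ 2 - C (f β) * X + 1 : (AlgebraicClosure F)[X]).degree = 2 := by compute_degree!
        rw [this]
        norm_num)
    simp only [IsRoot, eval_add, eval_sub, eval_pow, eval_X, eval_mul, eval_C, eval_one] at hroot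
    have hq : q ≠ 0 := by
      rintro rfl
      simp at hroot
    have hqβ : q + q⁻¹ = f β := by
      field_simp
      linear_combination hroot
    have hq2 : q ^ 2 ≠ 1 := by
      intro h
      rcases (sq_eq_sq_iff_eq_or_eq_neg.1 (h.trans (one_pow 2).symm)) with rfl | rfl
      · exact hβ.1 (f.injective (by rw [← hqβ, map_ofNat]; norm_num))
      · exact hβ.2 (f.injective (by rw [← hqβ, map_neg, map_ofNat]; norm_num))
    have kc := hc.map f
    have kcs := hcs.map f
    have kϑ := hϑ.map f
    rw [← hqβ] at kc kcs kϑ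
    obtain ⟨hqd, hqi, a, b, c, h⟩ := geometric_of_cyclic (θ := fun i => f (Φ.θ i)) hq hq2 hd
      (fun i hi j hj hij => Φ.θ_inj i hi j hj (f.injective hij)) kc
    obtain ⟨-, -, as, bs, cs, hs⟩ := geometric_of_cyclic (θ := fun i => f (Φ.θs i)) hq hq2 hd
      (fun i hi j hj hij => Φ.θs_inj i hi j hj (f.injective hij)) kcs
    obtain ⟨x, y, z, hv⟩ := kϑ.exists_geometric hq hq2
    refine ⟨q, a, b, c, as, bs, cs, y, z, hq, hqβ, hqd, hqi, h, hs, fun i h1 h3 => ?_⟩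
    have hx := hv 0 (by omega)
    rw [hv0, map_zero] at hx
    have hi : q ^ i * q⁻¹ ^ i = 1 := by rw [← mul_pow, mul_inv_cancel₀ hq, one_pow]
    have e1 : q ^ (d - i + 1) = q⁻¹ ^ i := by
      have : q ^ (d - i + 1) * q ^ i = 1 := by
        rw [← pow_add, show d - i + 1 + i = d + 1 by omega, hqd]
      linear_combination q⁻¹ ^ i * this - q ^ (d - i + 1) * hi
    have e2 : q⁻¹ ^ (d - i + 1) = q ^ i := by
      rw [inv_pow, e1, inv_pow, inv_inv]
    have k1 := hs i h3
    have k2 := hs 0 (by omega)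
    have k3 := h (d - i + 1) (by omega)
    have k4 := h 0 (by omega)
    simp only [e1, e2] at k1 k2 k3 k4
    rw [hφ i h1 h3, map_add, map_mul, map_sub, map_sub, hv i (by omega), k1, k2, k3, k4]
    simp only [pow_zero, mul_one] at hx ⊢
    linear_combination -hx + (z + cs * (b * q⁻¹ ^ i + c * q ^ i - b - c)
      + c * (bs * q ^ i + cs * q⁻¹ ^ i - bs - cs) - c * cs * (q ^ i * q⁻¹ ^ i - 1)) * hi
end

section
/- Let β ∈ F and let Φ = (A; {E_i}_{i=0}^d; A*; {E*_i}_{i=0}^d) be a CH system on V with parameter array ({θ_i}_{i=0}^d, {θ*_i}_{i=0}^d, {φ_i}_{i=1}^d). Then Φ is β-recurrent if and only if there exist scalars γ, γ*, ϱ, ϱ* ∈ F such that 0 = [A, A²A* − βAA*A + A*A² − γ(AA* + A*A) − ϱA*] and 0 = [A*, A*²A − βA*AA* + AA*² − γ*(A*A + AA*) − ϱ*A], where [r,s] = rs − sr. -/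
open Polynomial Finset Module

variable {F V : Type*} [Field F] [AddCommGroup V] [Module F V]

/-- The commutator `[A, A²B − βABA + BA² − γ(AB + BA) − ρB]`. -/
def tridiagComm (A B : Module.End F V) (β γ ρ : F) : Module.End F V :=
  A * (A^2 * B - β • (A * B * A) + B * A^2 - γ • (A * B + B * A) - ρ • B)
    - (A^2 * B - β • (A * B * A) + B * A^2 - γ • (A * B + B * A) - ρ • B) * A

lemma tridiagComm_apply (A B : Module.End F V) (β γ ρ : F) {v : ℤ → V} {τ σ a b : ℤ → F}
    (hA : ∀ i, A (v i) = τ i • v i + a i • v (i+1))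
    (hB : ∀ i, B (v i) = σ i • v i + b i • v (i-1)) (i : ℤ) :
    tridiagComm A B β γ ρ (v i) =
      (b i * ((τ (i-1) - τ i) * (τ (i-1)^2 - β * τ (i-1) * τ i + τ i^2 - γ * (τ (i-1) + τ i) - ρ))) • v (i-1)
      + (a i * b (i+1) * (-(β+1) * τ i^2 + (β+1) * τ i * (τ i + τ (i+1)) - (τ i^2 + τ i * τ (i+1) + τ (i+1)^2)
            + γ * (τ i + τ (i+1)) + ρ)
        + a (i-1) * b i * (τ (i-1)^2 + τ (i-1) * τ i + τ i^2 - (β+1) * (τ (i-1) + τ i) * τ i + (β+1) * τ i^2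
            - γ * (τ (i-1) + τ i) - ρ)) • v i
      + (a i * (σ i * (τ i^2 + τ i * τ (i+1) + τ (i+1)^2 - (β+1) * (τ i + τ (i+1)) * τ i + (β+1) * τ i^2
            - γ * (τ i + τ (i+1)) - ρ)
        + σ (i+1) * (-(β+1) * τ (i+1)^2 + (β+1) * τ (i+1) * (τ i + τ (i+1)) - (τ i^2 + τ i * τ (i+1) + τ (i+1)^2)
            + γ * (τ i + τ (i+1)) + ρ)
        + a (i-1) * b i * (τ (i-1) + τ i + τ (i+1) - (β+1) * τ i - γ)
        + a (i+1) * b (i+2) * ((β+1) * τ (i+1) - (τ i + τ (i+1) + τ (i+2)) + γ))) • v (i+1)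
      + (a i * a (i+1) * (σ i * (τ i + τ (i+1) + τ (i+2) - (β+1) * τ i - γ)
        + σ (i+1) * ((β+1) * (τ i + τ (i+1)) - (β+1) * (τ (i+1) + τ (i+2)))
        + σ (i+2) * ((β+1) * τ (i+2) - (τ i + τ (i+1) + τ (i+2)) + γ)
        + a (i-1) * b i - (β+1) * (a i * b (i+1)) + (β+1) * (a (i+1) * b (i+2)) - a (i+2) * b (i+3))) • v (i+2)
      + (a i * a (i+1) * a (i+2) * (σ i - (β+1) * σ (i+1) + (β+1) * σ (i+2) - σ (i+3))) • v (i+3) := by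
  have h₀ := hA (i-1)
  have h₂ := hB (i+1)
  have h₃ := hB (i+2)
  have h₄ := hB (i+3)
  have k₂ := hA (i+1)
  have k₃ := hA (i+2)
  rw [show i - 1 + 1 = i by ring] at h₀
  rw [show i + 1 - 1 = i by ring] at h₂
  rw [show i + 2 - 1 = i + 1 by ring] at h₃
  rw [show i + 3 - 1 = i + 2 by ring] at h₄
  rw [show i + 1 + 1 = i + 2 by ring] at k₂
  rw [show i + 2 + 1 = i + 3 by ring] at k₃
  simp only [tridiagComm, pow_two, LinearMap.sub_apply, Module.End.mul_apply, LinearMap.add_apply,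
    LinearMap.smul_apply, map_add, map_sub, map_smul, h₀, hA i, k₂, k₃, hB i, h₂, h₃, h₄]
  module

/-- If `τ` and `σ` satisfy three-term recurrences, the commutator shifts each `v i` by two. -/
lemma tridiagComm_apply_of_recurrent (A B : Module.End F V) {β γ γ' ρ : F} {v : ℤ → V}
    {τ σ a b : ℤ → F}
    (hA : ∀ i, A (v i) = τ i • v i + a i • v (i+1))
    (hB : ∀ i, B (v i) = σ i • v i + b i • v (i-1))
    (hτ : ∀ i, τ (i-1) - β * τ i + τ (i+1) = γ)
    (hρ : ∀ i, τ i ^ 2 - β * τ i * τ (i+1) + τ (i+1) ^ 2 - γ * (τ i + τ (i+1)) = ρ)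
    (hσ : ∀ i, σ (i-1) - β * σ i + σ (i+1) = γ')
    {ϑ : ℤ → F} {s t : F} (hϑ : ∀ i, ϑ i = a (i-1) * b i - (σ i - s) * (τ (i-1) - t)) (i : ℤ) :
    tridiagComm A B β γ ρ (v i) =
      (a i * a (i+1) * (ϑ i - (β+1) * ϑ (i+1) + (β+1) * ϑ (i+2) - ϑ (i+3))) • v (i+2) := by
  have r₁ := hρ i
  have t₀ := hτ i
  have t₁ := hτ (i+1)
  have s₁ := hσ (i+1)
  have s₂ := hσ (i+2)
  have ϑ₁ := hϑ (i+1)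
  have ϑ₂ := hϑ (i+2)
  have ϑ₃ := hϑ (i+3)
  rw [show i + 1 - 1 = i by ring] at ϑ₁ t₁ s₁
  rw [show i + 1 + 1 = i + 2 by ring] at t₁ s₁
  rw [show i + 2 - 1 = i + 1 by ring] at ϑ₂ s₂
  rw [show i + 2 + 1 = i + 3 by ring] at s₂
  rw [show i + 3 - 1 = i + 2 by ring] at ϑ₃
  rw [hϑ i, ϑ₁, ϑ₂, ϑ₃, tridiagComm_apply A B β γ ρ hA hB i]
  have e₀ : τ (i-1) = γ + β * τ i - τ (i+1) := by linear_combination t₀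
  have e₂ : τ (i+2) = γ + β * τ (i+1) - τ i := by linear_combination t₁
  have f₂ : σ (i+2) = γ' + β * σ (i+1) - σ i := by linear_combination s₁
  have f₃ : σ (i+3) = γ' + β * σ (i+2) - σ (i+1) := by linear_combination s₂
  subst r₁
  rw [e₀, e₂, f₃, f₂]
  module

/-- A finite `β`-recurrent sequence extends to a two-sided one. -/
lemma BetaRecurrent.exists_extension {β : F} {n : ℕ} {s : ℕ → F} (h : BetaRecurrent β n s) :
    ∃ (γ : F) (t : ℤ → F), (∀ i, t (i-1) - β * t i + t (i+1) = γ) ∧ ∀ i : ℕ, i ≤ n → t i = s i := by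
  set γ : F := s 0 - β * s 1 + s 2 with hγ
  let T : Equiv.Perm (F × F) :=
    { toFun := fun p => (p.2, γ + β * p.2 - p.1)
      invFun := fun p => (γ + β * p.1 - p.2, p.1)
      left_inv := fun p => by ext <;> simp
      right_inv := fun p => by ext <;> simp }
  have hT : ∀ (i : ℤ), (T ^ (i+1)) (s 0, s 1) =
      (((T ^ i) (s 0, s 1)).2, γ + β * ((T ^ i) (s 0, s 1)).2 - ((T ^ i) (s 0, s 1)).1) := by
    intro i
    rw [add_comm, zpow_add, zpow_one, Equiv.Perm.mul_apply]
    rfl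
  have hrec : ∀ i : ℤ, ((T ^ (i-1)) (s 0, s 1)).1 - β * ((T ^ i) (s 0, s 1)).1
      + ((T ^ (i+1)) (s 0, s 1)).1 = γ := by
    intro i
    have h₁ := hT (i-1)
    rw [show i - 1 + 1 = i by ring] at h₁
    rw [hT i, h₁]
    ring
  refine ⟨γ, fun i => ((T ^ i) (s 0, s 1)).1, hrec, fun i => ?_⟩
  beta_reduce
  induction i using Nat.strong_induction_on with
  | _ i ih =>
    intro hi
    match i, ih, hi with
    | 0, _, _ => simp
    | 1, _, _ => simp [T]
    | j + 2, ih, hi =>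
      have hs : ∀ k, k + 2 ≤ n → s k - β * s (k+1) + s (k+2) = γ := by
        intro k
        induction k with
        | zero => intro _; rw [hγ]
        | succ k ihk =>
          intro hk
          have := h (k+2) (by omega) (by omega)
          simp only [Nat.add_sub_cancel, show k + 2 - 1 = k + 1 by omega] at this
          rw [show k + 1 + 1 = k + 2 by ring, show k + 1 + 2 = k + 2 + 1 by ring]
          linear_combination ihk (by omega) - this
      have h₀ := ih j (by omega) (by omega)
      have h₁ := ih (j+1) (by omega) (by omega)
      have h₂ := hrec (j+1)
      rw [show (j : ℤ) + 1 - 1 = j by ring, h₀] at h₂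
      push_cast at h₁ ⊢
      rw [h₁, show (j : ℤ) + 1 + 1 = j + 2 by ring] at h₂
      linear_combination h₂ - hs j hi

/-- A three-term recurrence on `ℤ` has a quadratic first integral. -/
lemma exists_quadratic_invariant {β γ : F} {t : ℤ → F}
    (h : ∀ i, t (i-1) - β * t i + t (i+1) = γ) :
    ∃ ρ, ∀ i, t i ^ 2 - β * t i * t (i+1) + t (i+1) ^ 2 - γ * (t i + t (i+1)) = ρ := by
  have key : ∀ i, t i ^ 2 - β * t i * t (i+1) + t (i+1) ^ 2 - γ * (t i + t (i+1))
      = t (i-1) ^ 2 - β * t (i-1) * t i + t i ^ 2 - γ * (t (i-1) + t i) := by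
    intro i
    linear_combination (t (i+1) - t (i-1)) * h i
  refine ⟨t 0 ^ 2 - β * t 0 * t (0+1) + t (0+1) ^ 2 - γ * (t 0 + t (0+1)), fun i => ?_⟩
  induction i using Int.induction_on with
  | zero => rfl
  | succ i ih =>
    have := key (i+1)
    rw [show (i : ℤ) + 1 - 1 = i by ring] at this
    rw [this, ih]
  | pred i ih =>
    have := key (-i)
    rw [ih] at this
    rw [show -(i : ℤ) - 1 + 1 = -i by ring, ← this]

/-- The weights of a split basis extended to `ℤ`. -/
def splitUp (i : ℤ) : F := if i = -1 then 0 else 1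

/-- The split sequence extended by zero to `ℤ`. -/
def splitDown (d : ℕ) (φ : ℕ → F) (i : ℤ) : F := if 1 ≤ i ∧ i ≤ d then φ i.toNat else 0

lemma splitUp_mul_splitDown (d : ℕ) (φ : ℕ → F) (i : ℤ) :
    splitUp (i-1) * splitDown d φ i = splitDown d φ i := by
  unfold splitUp splitDown
  split_ifs <;> first | omega | simp

/-- A split basis extended by zero to `ℤ`, together with its coordinate functionals. -/
lemma SplitSeq.exists_int_basis {d : ℕ} {A As : Module.End F V} {θ θs φ : ℕ → F}
    (h : SplitSeq d A As θ θs φ) :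
    ∃ v : ℤ → V, (∀ i, i < 0 ∨ (d : ℤ) < i → v i = 0) ∧
      (∀ X : Module.End F V, (∀ i, 0 ≤ i → i ≤ (d : ℤ) → X (v i) = 0) → X = 0) ∧
      (∀ k : ℤ, 0 ≤ k → k ≤ d → ∃ f : V →ₗ[F] F, ∀ i, f (v i) = if i = k then 1 else 0) ∧
      (∀ τ : ℤ → F, (∀ i : ℕ, i ≤ d → τ i = θ (d - i)) →
        ∀ i, A (v i) = τ i • v i + splitUp (F := F) i • v (i+1)) ∧
      (∀ σ : ℤ → F, (∀ i : ℕ, i ≤ d → σ i = θs i) →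
        ∀ i, As (v i) = σ i • v i + splitDown d φ i • v (i-1)) := by
  obtain ⟨u, hli, hspan, hA, hAd, hAs0, hAs⟩ := h
  have hrange : Set.range (fun i : Fin (d+1) => u i) = u '' Set.Iic d := by
    ext x
    constructor
    · rintro ⟨i, rfl⟩
      exact ⟨i, Nat.lt_succ_iff.mp i.2, rfl⟩
    · rintro ⟨i, hi, rfl⟩
      exact ⟨⟨i, Nat.lt_succ_iff.mpr hi⟩, rfl⟩
  let v : ℤ → V := fun i => if 0 ≤ i ∧ i ≤ d then u i.toNat else 0
  have hv : ∀ i : ℕ, i ≤ d → v i = u i := fun i hi => by simp [v, hi]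
  have hv0 : ∀ i, i < 0 ∨ (d : ℤ) < i → v i = 0 := by
    intro i hi
    exact if_neg (by omega)
  refine ⟨v, hv0, ?_, ?_, ?_, ?_⟩
  · intro X hX
    refine LinearMap.ext_on hspan ?_
    rintro _ ⟨i, hi, rfl⟩
    have := hX i (by omega) (by exact_mod_cast hi)
    rwa [hv i hi] at this
  · intro k hk₀ hk
    let B := Basis.mk hli (by rw [hrange, hspan])
    have hB : ∀ i : Fin (d+1), B i = u i := fun i => by simp [B]
    lift k to ℕ using hk₀
    have hk : k ≤ d := by exact_mod_cast hk
    refine ⟨B.coord ⟨k, by omega⟩, fun i => ?_⟩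
    by_cases hi : 0 ≤ i ∧ i ≤ d
    · obtain ⟨hi₀, hi⟩ := hi
      lift i to ℕ using hi₀
      have hi : i ≤ d := by exact_mod_cast hi
      have := hB ⟨i, by omega⟩
      rw [hv i hi]
      simp only at this
      rw [← this, Basis.coord_apply, Basis.repr_self, Finsupp.single_apply]
      simp
    · rw [hv0 i (by omega), map_zero, if_neg (by omega)]
  · intro τ hτ i
    by_cases hi : 0 ≤ i ∧ i ≤ d
    · obtain ⟨hi₀, hi⟩ := hi
      lift i to ℕ using hi₀
      have hi : i ≤ d := by exact_mod_cast hi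
      have hup : splitUp (F := F) (i : ℤ) = 1 := if_neg (by omega)
      rw [hv i hi, hτ i hi, hup, one_smul]
      rcases hi.lt_or_eq with hlt | rfl
      · rw [hA i hlt, ← hv (i+1) hlt]
        rfl
      · rw [hAd, hv0 (i+1) (by omega), add_zero, Nat.sub_self]
    · rw [hv0 i (by omega), map_zero, smul_zero, zero_add]
      by_cases h₁ : i = -1
      · simp [splitUp, h₁]
      · rw [hv0 (i+1) (by omega), smul_zero]
  · intro σ hσ i
    by_cases hi : 0 ≤ i ∧ i ≤ d
    · obtain ⟨hi₀, hi⟩ := hi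
      lift i to ℕ using hi₀
      have hi : i ≤ d := by exact_mod_cast hi
      rw [hv i hi, hσ i hi]
      rcases Nat.eq_zero_or_pos i with rfl | hpos
      · rw [hAs0, hv0 _ (by simp), smul_zero, add_zero]
      · have hdown : splitDown d φ (i : ℤ) = φ i := by
          rw [splitDown, if_pos (by omega), Int.toNat_natCast]
        rw [hAs i hpos hi, hdown, ← hv (i-1) (by omega), Nat.cast_sub hpos]
        rfl
    · rw [hv0 i (by omega), map_zero, smul_zero, zero_add, splitDown, if_neg (by omega), zero_smul]

lemma vth_eq_splitDown {d : ℕ} {θ θs φ : ℕ → F} {t σ : ℤ → F}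
    (ht : ∀ i : ℕ, i ≤ d → t i = θ i) (hσ : ∀ i : ℕ, i ≤ d → σ i = θs i)
    {i : ℕ} (hi : i ≤ d + 1) :
    vth d θ θs φ i = splitDown d φ i - (σ i - σ 0) * (t (d - (i - 1)) - t 0) := by
  have hσ0 : σ 0 = θs 0 := hσ 0 (by omega)
  have ht0 : t 0 = θ 0 := ht 0 (by omega)
  by_cases h : 1 ≤ i ∧ i ≤ d
  · have e : (d : ℤ) - (i - 1) = ((d - i + 1 : ℕ) : ℤ) := by omega
    rw [vth, if_pos h, splitDown, if_pos (by omega), e, ht _ (by omega), hσ i h.2, hσ0, ht0,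
      Int.toNat_natCast]
  · rw [vth, if_neg h, splitDown, if_neg (by omega)]
    rcases (by omega : i = 0 ∨ i = d + 1) with rfl | rfl
    · simp
    · simp

lemma SplitSeq.tridiagComm_eq_zero {d : ℕ} {A As : Module.End F V} {θ θs φ : ℕ → F} {β : F}
    (hsplit : SplitSeq d A As θ θs φ) (hθ : BetaRecurrent β d θ) (hθs : BetaRecurrent β d θs)
    (hϑ : BetaRecurrent β (d+1) (vth d θ θs φ)) :
    ∃ γ γs ρ ρs : F, tridiagComm A As β γ ρ = 0 ∧ tridiagComm As A β γs ρs = 0 := by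
  obtain ⟨v, hv0, hext, -, hA, hAs⟩ := hsplit.exists_int_basis
  obtain ⟨γ, t, ht, htθ⟩ := hθ.exists_extension
  obtain ⟨γs, σ, hσ, hσθ⟩ := hθs.exists_extension
  obtain ⟨ρ, hρ⟩ := exists_quadratic_invariant ht
  obtain ⟨ρs, hρs⟩ := exists_quadratic_invariant hσ
  have hA' := hA (fun i => t (d - i)) fun i hi => by
    rw [← Nat.cast_sub hi, htθ _ (Nat.sub_le d i)]
  have hAs' := hAs σ hσθ
  set ϑ : ℤ → F := fun i => splitDown d φ i - (σ i - σ 0) * (t (d - (i - 1)) - t 0) with hϑ_def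
  have hD : ∀ j : ℤ, 0 ≤ j → j + 2 ≤ d →
      ϑ j - (β+1) * ϑ (j+1) + (β+1) * ϑ (j+2) - ϑ (j+3) = 0 := by
    intro j hj₀ hj
    lift j to ℕ using hj₀
    have := hϑ (j+2) (by omega) (by omega)
    simp only [Nat.add_sub_cancel, show j + 2 - 1 = j + 1 by omega, add_assoc] at this
    rw [vth_eq_splitDown htθ hσθ (by omega), vth_eq_splitDown htθ hσθ (by omega),
      vth_eq_splitDown htθ hσθ (by omega), vth_eq_splitDown htθ hσθ (by omega)] at this
    exact_mod_cast this
  refine ⟨γ, γs, ρ, ρs, hext _ fun i hi₀ hi => ?_, hext _ fun i hi₀ hi => ?_⟩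
  · rw [tridiagComm_apply_of_recurrent A As (γ' := γs) hA' hAs' (fun i => ?_) (fun i => ?_) hσ
      (ϑ := ϑ) (s := σ 0) (t := t 0) (fun i => ?_) i]
    · by_cases h : i + 2 ≤ d
      · rw [hD i hi₀ h, mul_zero, zero_smul]
      · rw [hv0 (i+2) (by omega), smul_zero]
    · have := ht (d - i)
      rw [show (d : ℤ) - (i - 1) = d - i + 1 by ring, show (d : ℤ) - (i + 1) = d - i - 1 by ring]
      linear_combination this
    · have := hρ (d - (i + 1))
      rw [show (d : ℤ) - (i + 1) + 1 = d - i by ring] at this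
      linear_combination this
    · rw [splitUp_mul_splitDown]
  · have key := tridiagComm_apply_of_recurrent As A (β := β) (γ := γs) (γ' := γ) (ρ := ρs)
      (v := fun j => v (d - j)) (τ := fun j => σ (d - j)) (σ := t)
      (a := fun j => splitDown d φ (d - j)) (b := fun j => splitUp (d - j))
      (fun j => ?_) (fun j => ?_) (fun j => ?_) (fun j => ?_) ht
      (ϑ := fun j => ϑ (d + 1 - j)) (s := t 0) (t := σ 0) (fun j => ?_) (d - i)
    · rw [show (d : ℤ) - (d - i) = i by ring] at key
      rw [key]
      by_cases h : 2 ≤ i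
      · have hDi := hD (i - 2) (by omega) (by omega)
        rw [show i - 2 + 1 = i - 1 by ring, show i - 2 + 2 = i by ring,
          show i - 2 + 3 = i + 1 by ring] at hDi
        rw [show (d : ℤ) + 1 - (d - i) = i + 1 by ring,
          show (d : ℤ) + 1 - (d - i + 1) = i by ring,
          show (d : ℤ) + 1 - (d - i + 2) = i - 1 by ring,
          show (d : ℤ) + 1 - (d - i + 3) = i - 2 by ring,
          show ϑ (i + 1) - (β+1) * ϑ i + (β+1) * ϑ (i - 1) - ϑ (i - 2) = 0 by
            linear_combination -hDi, mul_zero, zero_smul]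
      · rw [hv0 _ (by omega), smul_zero]
    · rw [hAs', show (d : ℤ) - (j + 1) = d - j - 1 by ring]
    · rw [hA', show (d : ℤ) - (d - j) = j by ring, show (d : ℤ) - (j - 1) = d - j + 1 by ring]
    · have := hσ (d - j)
      rw [show (d : ℤ) - (j - 1) = d - j + 1 by ring, show (d : ℤ) - (j + 1) = d - j - 1 by ring]
      linear_combination this
    · have := hρs (d - (j + 1))
      rw [show (d : ℤ) - (j + 1) + 1 = d - j by ring] at this
      linear_combination this
    · have := splitUp_mul_splitDown d φ (d + 1 - j)
      rw [show (d : ℤ) + 1 - j - 1 = d - j by ring] at this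
      simp only [hϑ_def]
      rw [show (d : ℤ) - (j - 1) = d + 1 - j by ring,
        show (d : ℤ) - (d + 1 - j - 1) = j by ring]
      linear_combination -this

lemma SplitSeq.recurrent_of_tridiagComm {d : ℕ} {A As : Module.End F V} {θ θs φ : ℕ → F} {β γ ρ : F}
    (hsplit : SplitSeq d A As θ θs φ) (hinj : ∀ i ≤ d, ∀ j ≤ d, θ i = θ j → i = j)
    (hφ : ∀ i, 1 ≤ i → i ≤ d → φ i ≠ 0) (h : tridiagComm A As β γ ρ = 0) :
    BetaRecurrent β d θ ∧ BetaRecurrent β d θs ∧ BetaRecurrent β (d+1) (vth d θ θs φ) := by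
  obtain ⟨v, -, -, hf, hA, hAs⟩ := hsplit.exists_int_basis
  have hup : ∀ i : ℤ, 0 ≤ i → splitUp (F := F) i = 1 := fun i hi => if_neg (by omega)
  have expand := tridiagComm_apply A As β γ ρ
    (hA (fun i => θ (d - i).toNat) fun i _ => by congr 1; omega)
    (hAs (fun i => θs i.toNat) fun i _ => by congr 1)
  simp only [h, LinearMap.zero_apply] at expand
  have hP : ∀ i, i + 1 ≤ d →
      θ i ^ 2 - β * θ i * θ (i+1) + θ (i+1) ^ 2 - γ * (θ i + θ (i+1)) = ρ := by
    intro i hi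
    obtain ⟨f, hfv⟩ := hf (d - i - 1) (by omega) (by omega)
    have := congrArg f (expand (d - i))
    simp only [map_add, map_smul, hfv, map_zero, smul_eq_mul] at this
    rw [if_pos trivial, if_neg (by omega), if_neg (by omega), if_neg (by omega), if_neg (by omega),
      show ((d : ℤ) - (d - i - 1)).toNat = i + 1 by omega,
      show ((d : ℤ) - (d - i)).toNat = i by omega, splitDown, if_pos (by omega),
      show ((d : ℤ) - i).toNat = d - i by omega] at this
    have h₁ := hφ (d - i) (by omega) (by omega)
    have h₂ : θ (i+1) - θ i ≠ 0 := fun h₀ => by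
      have := hinj _ hi _ (by omega) (sub_eq_zero.mp h₀)
      omega
    have h₃ := mul_left_cancel₀ (mul_ne_zero h₁ h₂) (b := θ (i+1) ^ 2 - β * θ (i+1) * θ i
      + θ i ^ 2 - γ * (θ (i+1) + θ i) - ρ) (c := 0) (by linear_combination -this)
    linear_combination h₃
  have hθγ : ∀ i, i + 2 ≤ d → θ i - β * θ (i+1) + θ (i+2) = γ := by
    intro i hi
    have h₂ : θ i - θ (i+2) ≠ 0 := fun h₀ => by
      have := hinj _ (by omega) _ hi (sub_eq_zero.mp h₀)
      omega
    have h₃ := mul_left_cancel₀ h₂ (b := θ i - β * θ (i+1) + θ (i+2) - γ) (c := 0)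
      (by linear_combination hP i (by omega) - hP (i+1) hi)
    linear_combination h₃
  have hθ : BetaRecurrent β d θ := by
    intro i hi₂ hi
    obtain ⟨k, rfl⟩ := Nat.exists_eq_add_of_le' hi₂
    rw [show k + 2 - 1 = k + 1 by omega, Nat.add_sub_cancel]
    linear_combination hθγ k (by omega) - hθγ (k+1) hi
  have hθs : BetaRecurrent β d θs := by
    intro i hi₂ hi
    obtain ⟨k, rfl⟩ := Nat.exists_eq_add_of_le' hi₂
    obtain ⟨f, hfv⟩ := hf (k + 3) (by omega) (by omega)
    have := congrArg f (expand k)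
    simp only [map_add, map_smul, hfv, map_zero, smul_eq_mul] at this
    rw [if_neg (by omega), if_neg (by omega), if_neg (by omega), if_neg (by omega), if_pos trivial,
      hup k (by omega), hup (k+1) (by omega), hup (k+2) (by omega), Int.toNat_natCast,
      show ((k : ℤ) + 1).toNat = k + 1 by omega, show ((k : ℤ) + 2).toNat = k + 2 by omega,
      show ((k : ℤ) + 3).toNat = k + 3 by omega] at this
    rw [show k + 2 - 1 = k + 1 by omega, Nat.add_sub_cancel]
    linear_combination -this
  refine ⟨hθ, hθs, ?_⟩
  intro i hi₂ hi
  obtain ⟨k, rfl⟩ := Nat.exists_eq_add_of_le' hi₂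
  obtain ⟨γ', t, ht, htθ⟩ := hθ.exists_extension
  obtain ⟨γs, σ, hσ, hσθ⟩ := hθs.exists_extension
  obtain ⟨ρ', hρ'⟩ := exists_quadratic_invariant ht
  have hγ' : γ' = γ := by
    have h₀ := htθ 0 (by omega)
    have h₁ := htθ 1 (by omega)
    have h₂ := htθ 2 (by omega)
    have h₃ := ht 1
    norm_num at h₀ h₁ h₂ h₃
    rw [← h₃, h₀, h₁, h₂, ← hθγ 0 (by omega)]
  have hρ_eq : ρ' = ρ := by
    have h₀ := htθ 0 (by omega)
    have h₁ := htθ 1 (by omega)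
    have h₃ := hρ' 0
    norm_num at h₀ h₁ h₃
    rw [← h₃, h₀, h₁, ← hP 0 (by omega), hγ']
  subst hγ' hρ_eq
  obtain ⟨f, hfv⟩ := hf (k + 2) (by omega) (by omega)
  have key := tridiagComm_apply_of_recurrent A As (β := β) (γ := γ') (γ' := γs) (ρ := ρ')
    (hA (fun i => t (d - i)) fun i hi => by rw [← Nat.cast_sub hi, htθ _ (Nat.sub_le d i)])
    (hAs σ hσθ) (fun i => ?_) (fun i => ?_) hσ
    (ϑ := fun i => splitDown d φ i - (σ i - σ 0) * (t (d - (i - 1)) - t 0))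
    (s := σ 0) (t := t 0) (fun i => ?_) k
  · have := congrArg f key
    rw [h, LinearMap.zero_apply, map_zero, map_smul, hfv, if_pos rfl, hup _ (by omega),
      hup _ (by omega)] at this
    rw [show k + 2 - 1 = k + 1 by omega, Nat.add_sub_cancel,
      vth_eq_splitDown htθ hσθ (by omega), vth_eq_splitDown htθ hσθ (by omega),
      vth_eq_splitDown htθ hσθ (by omega), vth_eq_splitDown htθ hσθ (by omega)]
    push_cast
    rw [show (k : ℤ) + 2 + 1 = k + 3 by ring]
    simp only [smul_eq_mul] at this
    linear_combination -this
  · have := ht (d - i)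
    rw [show (d : ℤ) - (i - 1) = d - i + 1 by ring, show (d : ℤ) - (i + 1) = d - i - 1 by ring]
    linear_combination this
  · have := hρ' (d - (i + 1))
    rw [show (d : ℤ) - (i + 1) + 1 = d - i by ring] at this
    linear_combination this
  · rw [splitUp_mul_splitDown]

/-- a CH system `Φ` is `β`-recurrent iff `A, A*` satisfy the tridiagonal
relations with parameter `β`. -/
theorem stmt2 {F V : Type*} [Field F] [AddCommGroup V] [Module F V]
    (d : ℕ) (hd : 3 ≤ d) (hdim : Module.finrank F V = d + 1)
    (Φ : CHSystem F V d) (φ : ℕ → F)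
    (hφ0 : ∀ i, 1 ≤ i → i ≤ d → φ i ≠ 0)
    (hsplit : SplitSeq d Φ.A Φ.As Φ.θ Φ.θs φ)
    (β : F) :
    (BetaRecurrent β d Φ.θ ∧ BetaRecurrent β d Φ.θs ∧
      BetaRecurrent β (d+1) (vth d Φ.θ Φ.θs φ)) ↔
    ∃ γ γs ρ ρs : F,
      (0 : Module.End F V) =
        Φ.A * (Φ.A^2 * Φ.As - β • (Φ.A * Φ.As * Φ.A) + Φ.As * Φ.A^2
                - γ • (Φ.A * Φ.As + Φ.As * Φ.A) - ρ • Φ.As)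
        - (Φ.A^2 * Φ.As - β • (Φ.A * Φ.As * Φ.A) + Φ.As * Φ.A^2
                - γ • (Φ.A * Φ.As + Φ.As * Φ.A) - ρ • Φ.As) * Φ.A ∧
      (0 : Module.End F V) =
        Φ.As * (Φ.As^2 * Φ.A - β • (Φ.As * Φ.A * Φ.As) + Φ.A * Φ.As^2
                - γs • (Φ.As * Φ.A + Φ.A * Φ.As) - ρs • Φ.A)
        - (Φ.As^2 * Φ.A - β • (Φ.As * Φ.A * Φ.As) + Φ.A * Φ.As^2
                - γs • (Φ.As * Φ.A + Φ.A * Φ.As) - ρs • Φ.A) * Φ.As := by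
  constructor
  · rintro ⟨hθ, hθs, hϑ⟩
    obtain ⟨γ, γs, ρ, ρs, h₁, h₂⟩ := hsplit.tridiagComm_eq_zero hθ hθs hϑ
    exact ⟨γ, γs, ρ, ρs, h₁.symm, h₂.symm⟩
  · rintro ⟨γ, γs, ρ, ρs, h₁, -⟩
    exact hsplit.recurrent_of_tridiagComm Φ.θ_inj hφ0 h₁.symm
end

section
/- Let Φ be a recurrent CH system on V with parameter array ({θ_i}_{i=0}^d, {θ*_i}_{i=0}^d, {φ_i}_{i=1}^d), and let {ϑ_i}_{i=0}^{d+1} be the associated scalars. Then ϑ_1 ≠ ϑ_d. -/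
open Polynomial Finset Module

variable {F V : Type*} [Field F] [AddCommGroup V] [Module F V]

/-- A linear recurrence of order two satisfies an addition formula in terms of its fundamental
solution `U`. -/
theorem linRec_add {R : Type*} [CommRing R] {β : R} {U e : ℕ → R}
    (hU0 : U 0 = 0) (hU1 : U 1 = 1) (hU : ∀ n, U (n+2) = β * U (n+1) - U n)
    (he : ∀ n, e (n+2) = β * e (n+1) - e n) (m k : ℕ) :
    e (m+k) = U m * e (k+1) - (β * U m - U (m+1)) * e k := by
  induction m using Nat.twoStepInduction with
  | zero => simp [hU0, hU1]
  | one =>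
    rw [hU 0, hU0, hU1, Nat.add_comm 1 k]
    ring
  | more n h1 h2 =>
    have h3 := he (n+k)
    rw [show n + 1 + k = n + k + 1 by ring] at h2
    rw [show n + 2 + k = n + k + 2 by ring, h3, h2, h1, hU (n+1), hU n]
    ring

theorem linRec_fundamental_sq {R : Type*} [CommRing R] {β : R} {U : ℕ → R}
    (hU0 : U 0 = 0) (hU1 : U 1 = 1) (hU : ∀ n, U (n+2) = β * U (n+1) - U n) (m : ℕ) :
    U (m+1) ^ 2 - β * U m * U (m+1) + U m ^ 2 = 1 := by
  induction m with
  | zero => simp [hU0, hU1]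
  | succ n ih =>
    rw [hU n]
    linear_combination ih

theorem exists_linRec {R : Type*} [CommRing R] (β a b : R) :
    ∃ e : ℕ → R, e 0 = a ∧ e 1 = b ∧ ∀ n, e (n+2) = β * e (n+1) - e n := by
  let f : ℕ → R × R := fun n => Nat.rec (a, b) (fun _ p => (p.2, β * p.2 - p.1)) n
  exact ⟨fun n => (f n).1, rfl, rfl, fun n => rfl⟩

/-- The key identity for a sequence `x` with partial sums `s` whose differences satisfy a linear
recurrence of order two, away from the degenerate case `β = 2`. -/
theorem partialSum_identity_of_ne_two {R : Type*} [CommRing R] [IsDomain R] {β : R}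
    (hβ : β - 2 ≠ 0) {e x s : ℕ → R}
    (he : ∀ n, e (n+2) = β * e (n+1) - e n) (hx : ∀ n, x (n+1) = x n + e (n+1))
    (hs0 : s 0 = 0) (hs : ∀ n, s (n+1) = s n + x n) (m k : ℕ) :
    (s (m+1) + s k - s (m+k+1)) * (x (m+k+1) - x m)
      - (s m + s (k+1) - s (m+k+1)) * (x 0 - x (m+1))
      = (x (m+k) - x 0) * (s (m+1) + s (k+1) - s (m+k+2)) := by
  obtain ⟨U, hU0, hU1, hU⟩ := exists_linRec β 0 1
  have hxe : ∀ n, (β - 2) * (x n - x 0) = e (n+1) - e n - (e 1 - e 0) := by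
    intro n
    induction n with
    | zero => ring
    | succ n ih =>
      rw [hx n, he n]
      linear_combination ih
  have hse : ∀ n, (β - 2) * (s n - n * x 0) = e n - e 0 - n * (e 1 - e 0) := by
    intro n
    induction n with
    | zero => simp [hs0]
    | succ n ih =>
      rw [hs n]
      push_cast
      linear_combination ih + hxe n
  have hsub : ∀ a b, (β - 2) * (x a - x b) = (e (a+1) - e a) - (e (b+1) - e b) := by
    intro a b
    linear_combination hxe a - hxe b
  have hB : ∀ a b, (β - 2) * (s a + s b - s (a+b)) = e a + e b - e (a+b) - e 0 := by
    intro a b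
    have h := hse (a+b)
    push_cast at h
    linear_combination hse a + hse b - h
  have h1 := hB (m+1) k
  have h2 := hB m (k+1)
  have h3 := hB (m+1) (k+1)
  have h4 := hsub (m+k+1) m
  have h5 := hsub 0 (m+1)
  have h6 := hsub (m+k) 0
  rw [show m + 1 + k = m + k + 1 by ring] at h1
  rw [show m + (k + 1) = m + k + 1 by ring] at h2
  rw [show m + 1 + (k + 1) = m + k + 2 by ring] at h3
  apply mul_left_cancel₀ (mul_ne_zero hβ hβ)
  have key : (e (m+1) + e k - e (m+k+1) - e 0) * ((e (m+k+2) - e (m+k+1)) - (e (m+1) - e m))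
      - (e m + e (k+1) - e (m+k+1) - e 0) * ((e 1 - e 0) - (e (m+2) - e (m+1)))
      = ((e (m+k+1) - e (m+k)) - (e 1 - e 0)) * (e (m+1) + e (k+1) - e (m+k+2) - e 0) := by
    have hm := linRec_fundamental_sq hU0 hU1 hU m
    have hk := linRec_fundamental_sq hU0 hU1 hU k
    have a0 := linRec_add hU0 hU1 hU he m k
    have a1 := linRec_add hU0 hU1 hU he m (k+1)
    have b0 := linRec_add hU0 hU1 hU he m 0
    have b1 := linRec_add hU0 hU1 hU he m 1
    have c0 := linRec_add hU0 hU1 hU he k 0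
    have c1 := linRec_add hU0 hU1 hU he k 1
    have d2 := he 0
    simp only [Nat.add_zero, Nat.zero_add, Nat.reduceAdd] at b0 b1 c0 c1 d2
    rw [← Nat.add_assoc, he k] at a1
    rw [he (m+k), he m, a1, a0, b1, b0, c1, c0, d2]
    generalize U (m+1) = A' at *
    generalize U m = A at *
    generalize U (k+1) = B' at *
    generalize U k = B at *
    generalize e 0 = E at *
    generalize e 1 = E' at *
    linear_combination (- E'^2 + E*E'*β - E^2 + B'^2*E'^2 - B'^2*E*E'*β + B'^2*E^2 - B*B'*E'^2*β
      + B*B'*E*E'*β^2 - B*B'*E^2*β + B^2*E'^2 - B^2*E*E'*β + B^2*E^2) * hm + (E'^2 - E*E'*β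
      + E^2 - A'*E'^2 + A'*E*E'*β - A'*E^2 + A*E'^2 - A*E*E'*β + A*E^2) * hk
  linear_combination key + h1 * ((β - 2) * (x (m+k+1) - x m))
    + (e (m+1) + e k - e (m+k+1) - e 0) * h4
    - h2 * ((β - 2) * (x 0 - x (m+1))) - (e m + e (k+1) - e (m+k+1) - e 0) * h5
    - h6 * ((β - 2) * (s (m+1) + s (k+1) - s (m+k+2)))
    - ((e (m+k+1) - e (m+k)) - (e 1 - e 0)) * h3

/-- The partial sums of a `β`-recurrent sequence satisfy a quadratic identity. -/
theorem BetaRecurrent.partialSum_identity {F : Type*} [Field F] {β : F} {d : ℕ} {x : ℕ → F}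
    (hx : BetaRecurrent β d x) {m k : ℕ} (hmk : m + k + 1 ≤ d) {s : ℕ → F}
    (hs : ∀ n, s n = ∑ h ∈ range n, x h) :
    (s (m+1) + s k - s (m+k+1)) * (x (m+k+1) - x m)
      - (s m + s (k+1) - s (m+k+1)) * (x 0 - x (m+1))
      = (x (m+k) - x 0) * (s (m+1) + s (k+1) - s (m+k+2)) := by
  obtain ⟨e, he0, he1, he⟩ := exists_linRec (X : F[X]) (X * C (x 1 - x 0) - C (x 2 - x 1))
    (C (x 1 - x 0))
  have hβ : (X : F[X]) - 2 ≠ 0 := by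
    have h := X_sub_C_ne_zero (2 : F)
    rwa [map_ofNat] at h
  set y : ℕ → F[X] := fun n => C (x 0) + ∑ h ∈ range n, e (h+1) with hy
  set t : ℕ → F[X] := fun n => ∑ h ∈ range n, y h with ht
  have hey : ∀ n, n + 1 ≤ d → (e (n+1)).eval β = x (n+1) - x n := by
    intro n
    induction n using Nat.twoStepInduction with
    | zero => simp [he1]
    | one =>
      intro _
      rw [he 0, he0]
      simp [he1]
    | more n h1 h2 =>
      intro hn
      have h3 := hx (n+2) (by omega) hn
      simp only [Nat.add_sub_cancel, show n + 2 - 1 = n + 1 from rfl] at h3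
      rw [he (n+1), eval_sub, eval_mul, eval_X, h2 (by omega), h1 (by omega)]
      linear_combination h3
  have hyx : ∀ n, n ≤ d → (y n).eval β = x n := by
    intro n
    induction n with
    | zero => simp [hy]
    | succ n ih =>
      intro hn
      have h : y (n+1) = y n + e (n+1) := by simp [hy, sum_range_succ, add_assoc]
      rw [h, eval_add, ih (by omega), hey n hn]
      ring
  have hts : ∀ n, n ≤ d + 1 → (t n).eval β = s n := by
    intro n hn
    rw [hs, ht, eval_finsetSum]
    refine sum_congr rfl fun h hh => hyx h ?_
    have := mem_range.1 hh
    omega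
  have key := partialSum_identity_of_ne_two hβ (x := y) (s := t) he
    (fun n => by simp [hy, sum_range_succ, add_assoc]) (by simp [ht])
    (fun n => by simp [ht, sum_range_succ]) m k
  have key' := congrArg (eval β) key
  simp only [eval_sub, eval_mul, eval_add] at key'
  rwa [hyx _ hmk, hyx m (by omega), hyx 0 (by omega), hyx (m+1) (by omega),
    hyx (m+k) (by omega), hts (m+1) (by omega), hts k (by omega), hts (m+k+1) (by omega),
    hts m (by omega), hts (k+1) (by omega), hts (m+k+2) (by omega)] at key'

theorem BetaRecurrent.second_order {F : Type*} [Field F] {β : F} {N : ℕ} {σ : ℕ → F}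
    (hσ : BetaRecurrent β N σ) (n : ℕ) (hn : n + 2 ≤ N) :
    σ (n+2) - β * σ (n+1) + σ n = σ 2 - β * σ 1 + σ 0 := by
  induction n with
  | zero => rfl
  | succ n ih =>
    have h := hσ (n+2) (by omega) (by omega)
    simp only [Nat.add_sub_cancel, show n + 2 - 1 = n + 1 from rfl] at h
    rw [← ih (by omega)]
    linear_combination -h

/-- A `β`-recurrent sequence vanishing at `0, 1, d, d + 1` is zero, as soon as there is a
`β`-recurrent sequence with distinct values at `0` and `d`. -/
theorem BetaRecurrent.eq_zero {F : Type*} [Field F] {β : F} {d : ℕ} (hd : 1 ≤ d) {x y : ℕ → F}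
    (hx : BetaRecurrent β d x) (hxd : x d ≠ x 0) (hy : BetaRecurrent β (d+1) y)
    (h0 : y 0 = 0) (h1 : y 1 = 0) (hyd : y d = 0) (hyd' : y (d+1) = 0) :
    ∀ n ≤ d + 1, y n = 0 := by
  have key : ∀ n, n + 1 ≤ d →
      y 2 * (x (n+1) - x 0) = y (n+1) * (x 2 - x 1) - (y n - y 2) * (x 1 - x 0) := by
    intro n
    induction n using Nat.twoStepInduction with
    | zero =>
      intro _
      simp only [Nat.zero_add, h0, h1]
      ring
    | one =>
      intro _
      simp only [Nat.reduceAdd, h1]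
      ring
    | more n ih1 ih2 =>
      intro hn
      have hx' := hx.second_order (n+1) hn
      have hy' := hy.second_order (n+1) (by omega)
      have hy'' := hy.second_order n (by omega)
      have e1 := ih1 (by omega)
      have e2 := ih2 (by omega)
      rw [h0, h1] at hy' hy''
      linear_combination y 2 * hx' - (x 2 - x 1) * hy' + (x 1 - x 0) * hy'' + β * e2 - e1
  have hy2 : y 2 = 0 := by
    obtain ⟨c, rfl⟩ : ∃ c, d = c + 1 := ⟨d - 1, by omega⟩
    have hc := hy.second_order c le_rfl
    rw [show c + 2 = c + 1 + 1 from rfl, hyd, hyd', h0, h1] at hc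
    have h := key c le_rfl
    rw [hyd] at h
    refine (mul_eq_zero.1 ?_).resolve_right (sub_ne_zero.2 hxd)
    linear_combination h - (x 1 - x 0) * hc
  intro n
  induction n using Nat.twoStepInduction with
  | zero => exact fun _ => h0
  | one => exact fun _ => h1
  | more n ih1 ih2 =>
    intro hn
    have h := hy.second_order n hn
    rw [h0, h1, hy2, ih1 (by omega), ih2 (by omega)] at h
    linear_combination h

theorem BetaRecurrent.reverse {F : Type*} [Field F] {β : F} {d : ℕ} {x : ℕ → F}
    (hx : BetaRecurrent β d x) : BetaRecurrent β d (fun n => x (d - n)) := by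
  intro i hi hid
  have h := hx (d - i + 1) (by omega) (by omega)
  rw [show d - i + 1 - 2 = d - (i + 1) by omega, show d - i + 1 - 1 = d - i by omega,
    show d - i + 1 + 1 = d - (i - 2) by omega, show d - i + 1 = d - (i - 1) by omega] at h
  linear_combination -h

/-- With `s` the partial sums of a `β`-recurrent sequence, `s n + s (d + 1 - n)` is
`β`-recurrent up to a constant. -/
theorem BetaRecurrent.partialSum_add_reverse {F : Type*} [Field F] {β : F} {d : ℕ} {x : ℕ → F}
    (hx : BetaRecurrent β d x) {s : ℕ → F} (hs : ∀ n, s n = ∑ h ∈ range n, x h) (c : F) :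
    BetaRecurrent β (d+1) (fun n => s n + s (d + 1 - n) - c) := by
  intro i hi hid
  obtain ⟨a, rfl⟩ : ∃ a, i = a + 2 := ⟨i - 2, by omega⟩
  obtain ⟨b, rfl⟩ : ∃ b, d = a + b + 2 := ⟨d - a - 2, by omega⟩
  have ha := hx.second_order a (by omega)
  have hb := hx.second_order b (by omega)
  have hs' : ∀ n, s (n+1) = s n + x n := fun n => by rw [hs, hs, sum_range_succ]
  dsimp only
  rw [show a + 2 - 2 = a by omega, show a + 2 - 1 = a + 1 by omega,
    show a + b + 2 + 1 - a = b + 2 + 1 by omega,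
    show a + b + 2 + 1 - (a + 1) = b + 1 + 1 by omega,
    show a + b + 2 + 1 - (a + 2) = b + 1 by omega,
    show a + b + 2 + 1 - (a + 2 + 1) = b by omega]
  have e1 := hs' (a+2)
  have e2 := hs' (a+1)
  have e3 := hs' a
  have e4 := hs' (b+2)
  have e5 := hs' (b+1)
  have e6 := hs' b
  rw [e1, e2, e3, e4, e5, e6]
  linear_combination hb - ha

/-- If `ϑ` is `β`-recurrent with `ϑ 1 = ϑ d` and vanishes at both ends, then the weighted sum
of `ϑ` computing the corner entry `E 0 * As * E d` vanishes. -/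
theorem BetaRecurrent.sum_smul_eq_zero {F V : Type*} [Field F] [AddCommGroup V] [Module F V]
    {β : F} {d : ℕ} (hd : 2 ≤ d) {x ϑ z : ℕ → F} {W : ℕ → V}
    (hx : BetaRecurrent β d x) (hxd : x d ≠ x 0) (hxd' : x (d-1) ≠ x 0)
    (hϑ : BetaRecurrent β (d+1) ϑ) (hϑ0 : ϑ 0 = 0) (hϑd : ϑ (d+1) = 0) (hϑ1 : ϑ 1 = ϑ d)
    (hz : ∀ i < d, z i = z (i+1) * (x 0 - x (i+1)))
    (hW : ∀ i < d, W (i+1) = (x d - x i) • W i) :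
    ∑ i ∈ range d, (z (i+1) * ϑ (i+1)) • W i = 0 := by
  obtain ⟨s, hs⟩ : ∃ s : ℕ → F, ∀ n, s n = ∑ h ∈ range n, x h := ⟨_, fun _ => rfl⟩
  have hs0 : s 0 = 0 := by simp [hs]
  have hs' : ∀ n, s (n+1) = s n + x n := fun n => by rw [hs, hs, sum_range_succ]
  have hs1 : s 1 = x 0 := by rw [hs' 0, hs0, zero_add]
  have ht := hx.partialSum_add_reverse hs (s (d+1))
  have hprop : ∀ n ≤ d + 1,
      (x 0 - x d) * ϑ n - ϑ 1 * (s n + s (d + 1 - n) - s (d+1)) = 0 := by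
    refine BetaRecurrent.eq_zero (by omega) hx hxd (β := β) ?_ ?_ ?_ ?_ ?_
    · intro i hi hid
      linear_combination (x 0 - x d) * hϑ i hi hid - ϑ 1 * ht i hi hid
    · simp [hϑ0, hs0]
    · rw [show d + 1 - 1 = d by omega, hs' d, hs1]
      ring
    · rw [show d + 1 - d = 1 by omega, hs' d, hs1, ← hϑ1]
      ring
    · simp [hϑd, hs0]
  have hne : (x 0 - x d) * (x (d-1) - x 0) ≠ 0 :=
    mul_ne_zero (sub_ne_zero.2 hxd.symm) (sub_ne_zero.2 hxd')
  refine (smul_eq_zero.1 ?_).resolve_left hne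
  set g : ℕ → V := fun i => (ϑ 1 * (s i + s (d - i) - s d) * z i) • W i with hg
  have hterm : ∀ i ∈ range d,
      ((x 0 - x d) * (x (d-1) - x 0)) • ((z (i+1) * ϑ (i+1)) • W i) = g (i+1) - g i := by
    intro i hi
    have hid := mem_range.1 hi
    obtain ⟨k, rfl⟩ : ∃ k, d = i + k + 1 := ⟨d - i - 1, by omega⟩
    have hid' := hx.partialSum_identity le_rfl hs
    have hp := hprop (i+1) (by omega)
    rw [show i + k + 1 + 1 - (i + 1) = k + 1 by omega] at hp
    rw [hg]
    dsimp only
    rw [hW i hid, hz i hid, show i + k + 1 - (i + 1) = k by omega,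
      show i + k + 1 - i = k + 1 by omega, show i + k + 1 - 1 = i + k by omega, smul_smul,
      smul_smul, ← sub_smul]
    congr 1
    linear_combination (x (i+k) - x 0) * z (i+1) * hp - ϑ 1 * z (i+1) * hid'
  rw [smul_sum, sum_congr rfl hterm, sum_range_sub]
  simp [hg, hs0]

theorem sub_mul_primIdem {F V : Type*} [Field F] [AddCommGroup V] [Module F V] {d : ℕ}
    {A : Module.End F V} {θ : ℕ → F}
    (hA : aeval A (∏ j ∈ range (d+1), (X - C (θ j))) = 0) {i : ℕ} (hi : i ≤ d) :
    (A - algebraMap F (Module.End F V) (θ i)) * primIdem d A θ i = 0 := by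
  have hi' : i ∈ range (d+1) := mem_range.2 (by omega)
  have h : (X - C (θ i)) * ∏ j ∈ (range (d+1)).erase i, (C (θ i - θ j)⁻¹ * (X - C (θ j)))
      = (∏ j ∈ (range (d+1)).erase i, C (θ i - θ j)⁻¹) * ∏ j ∈ range (d+1), (X - C (θ j)) := by
    rw [prod_mul_distrib, ← mul_prod_erase _ _ hi']
    ring
  have h' := congrArg (aeval A) h
  rw [map_mul, map_mul, hA, mul_zero, map_sub, aeval_X, aeval_C] at h'
  exact h'

theorem primIdem_mul_sub {F V : Type*} [Field F] [AddCommGroup V] [Module F V] {d : ℕ}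
    {A : Module.End F V} {θ : ℕ → F}
    (hA : aeval A (∏ j ∈ range (d+1), (X - C (θ j))) = 0) {i : ℕ} (hi : i ≤ d) :
    primIdem d A θ i * (A - algebraMap F (Module.End F V) (θ i)) = 0 := by
  rw [← sub_mul_primIdem hA hi]
  have h : aeval A (X - C (θ i)) = A - algebraMap F (Module.End F V) (θ i) := by simp
  rw [← h, primIdem, ← map_mul, ← map_mul, mul_comm]

theorem apply_primIdem {F V : Type*} [Field F] [AddCommGroup V] [Module F V] {d : ℕ}
    {A : Module.End F V} {θ : ℕ → F}
    (hA : aeval A (∏ j ∈ range (d+1), (X - C (θ j))) = 0) {i : ℕ} (hi : i ≤ d) (u : V) :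
    A (primIdem d A θ i u) = θ i • primIdem d A θ i u := by
  have h := LinearMap.congr_fun (sub_mul_primIdem hA hi) u
  simpa [Module.algebraMap_end_apply, sub_eq_zero] using h

theorem primIdem_apply {F V : Type*} [Field F] [AddCommGroup V] [Module F V] {d : ℕ}
    {A : Module.End F V} {θ : ℕ → F}
    (hA : aeval A (∏ j ∈ range (d+1), (X - C (θ j))) = 0) {i : ℕ} (hi : i ≤ d) (u : V) :
    primIdem d A θ i (A u) = θ i • primIdem d A θ i u := by
  have h := LinearMap.congr_fun (primIdem_mul_sub hA hi) u
  simpa [Module.algebraMap_end_apply, sub_eq_zero] using h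

/-- for a recurrent CH system, `ϑ 1 ≠ ϑ d`. -/
theorem stmt5 {F V : Type*} [Field F] [AddCommGroup V] [Module F V]
    (d : ℕ) (hd : 3 ≤ d) (hdim : Module.finrank F V = d + 1)
    (Φ : CHSystem F V d) (φ : ℕ → F)
    (hφ0 : ∀ i, 1 ≤ i → i ≤ d → φ i ≠ 0)
    (hsplit : SplitSeq d Φ.A Φ.As Φ.θ Φ.θs φ)
    (hrec : ∃ β : F, BetaRecurrent β d Φ.θ ∧ BetaRecurrent β d Φ.θs ∧
      BetaRecurrent β (d+1) (vth d Φ.θ Φ.θs φ)) :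
    vth d Φ.θ Φ.θs φ 1 ≠ vth d Φ.θ Φ.θs φ d := by
  intro hϑ1
  obtain ⟨β, hθ, -, hϑ⟩ := hrec
  obtain ⟨v, hli, hspan, hA, hAd, hAs0, hAs⟩ := hsplit
  have hne : ∀ i ≤ d, ∀ j ≤ d, i ≠ j → Φ.θ i ≠ Φ.θ j :=
    fun i hi j hj hij h => hij (Φ.θ_inj i hi j hj h)
  refine Φ.circ₂ 0 (by omega) d le_rfl (Or.inr (by simp)) (LinearMap.ext fun u => ?_)
  rw [Module.End.mul_apply, Module.End.mul_apply, LinearMap.zero_apply]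
  have hEZ := apply_primIdem Φ.A_ann le_rfl u
  set Z := primIdem d Φ.A Φ.θ d u
  have hE0 := primIdem_apply Φ.A_ann (Nat.zero_le d)
  set E := primIdem d Φ.A Φ.θ 0
  have hEZ0 : E Z = 0 := by
    have h := hE0 Z
    rw [hEZ, map_smul, ← sub_eq_zero, ← sub_smul] at h
    exact (smul_eq_zero.1 h).resolve_left
      (sub_ne_zero.2 (hne d le_rfl 0 (by omega) (by omega)))
  -- coordinates of `Z` in the split basis
  have himage : v '' Set.Iic d = Set.range (fun i : Fin (d+1) => v i) := by
    ext w
    constructor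
    · rintro ⟨i, hi, rfl⟩
      exact ⟨⟨i, Nat.lt_succ_of_le hi⟩, rfl⟩
    · rintro ⟨i, rfl⟩
      exact ⟨i, Nat.le_of_lt_succ i.2, rfl⟩
  have hZspan : Z ∈ Submodule.span F (Set.range (fun i : Fin (d+1) => v i)) := by
    rw [← himage, hspan]
    trivial
  obtain ⟨c, hc⟩ := (Submodule.mem_span_range_iff_exists_fun F).1 hZspan
  obtain ⟨z, hzc⟩ : ∃ z : ℕ → F, ∀ i : Fin (d+1), z i = c i :=
    ⟨fun n => if h : n < d + 1 then c ⟨n, h⟩ else 0, fun i => dif_pos i.2⟩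
  have hZ : Z = ∑ i ∈ range (d+1), z i • v i := by
    rw [← hc, ← Fin.sum_univ_eq_sum_range (fun i => z i • v i)]
    exact sum_congr rfl fun i _ => by rw [hzc]
  have hindep : ∀ a : ℕ → F, ∑ i ∈ range (d+1), a i • v i = 0 → ∀ i ≤ d, a i = 0 := by
    intro a ha i hi
    rw [← Fin.sum_univ_eq_sum_range (fun i => a i • v i)] at ha
    exact Fintype.linearIndependent_iff.1 hli (fun i => a i) ha ⟨i, Nat.lt_succ_of_le hi⟩
  have hz : ∀ i < d, z i = z (i+1) * (Φ.θ d - Φ.θ (d - (i+1))) := by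
    have hAZ : ∑ i ∈ range (d+1),
        (z i * (Φ.θ (d - i) - Φ.θ d) + if i = 0 then 0 else z (i-1)) • v i = 0 := by
      rw [← sub_eq_zero, hZ, map_sum, smul_sum, sum_range_succ, sum_range_succ _ d] at hEZ
      rw [← hEZ, map_smul, hAd]
      simp_rw [add_smul, sum_add_distrib]
      rw [sum_range_succ' (fun i => (if i = 0 then 0 else z (i-1)) • v i)]
      have h : ∀ i ∈ range d, Φ.A (z i • v i) =
          (z i * (Φ.θ (d - i) - Φ.θ d)) • v i + Φ.θ d • z i • v i + z i • v (i+1) := by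
        intro i hi
        rw [map_smul, hA i (mem_range.1 hi)]
        module
      rw [sum_congr rfl h, sum_add_distrib, sum_add_distrib, sum_range_succ]
      simp
      module
    intro i hi
    have h := hindep _ hAZ (i+1) (by omega)
    simp only [Nat.add_sub_cancel, Nat.succ_ne_zero, if_false] at h
    linear_combination h
  have hW : ∀ i < d, E (v (i+1)) = (Φ.θ 0 - Φ.θ (d - i)) • E (v i) := by
    intro i hi
    have h := hE0 (v i)
    rw [hA i hi, map_add, map_smul] at h
    rw [sub_smul, ← h]
    abel
  have hsum : E (Φ.As Z) =
      ∑ i ∈ range d, (z (i+1) * vth d Φ.θ Φ.θs φ (i+1)) • E (v i) := by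
    have h1 : E (Φ.As Z) = E (Φ.As Z) - Φ.θs 0 • E Z := by rw [hEZ0, smul_zero, sub_zero]
    rw [h1, hZ, map_sum, map_sum, map_sum, smul_sum, ← sum_sub_distrib, sum_range_succ']
    simp only [map_smul, hAs0]
    rw [smul_comm, sub_self, add_zero]
    refine sum_congr rfl fun i hi => ?_
    have hid := mem_range.1 hi
    rw [hAs (i+1) (by omega) (by omega), map_add, map_smul, map_smul, hW i hid, vth,
      if_pos ⟨by omega, by omega⟩, show d - (i + 1) + 1 = d - i by omega, Nat.add_sub_cancel]
    module
  rw [hsum]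
  refine BetaRecurrent.sum_smul_eq_zero (by omega) hθ.reverse ?_ ?_ hϑ (by simp [vth])
    (by simp [vth]) hϑ1 (by simpa using hz) (by simpa using hW)
  · exact hne _ (by omega) _ (by omega) (by omega)
  · exact hne _ (by omega) _ (by omega) (by omega)
end

section
/- Let Φ = (A; {E_i}_{i=0}^d; A*; {E*_i}_{i=0}^d) be a CH system on V, and let W be a nonzero subspace of V such that AW ⊆ W and A*W ⊆ W. Then W = V. -/
open Polynomial Finset Module

variable {F V : Type*} [Field F] [AddCommGroup V] [Module F V]

/-- A primitive idempotent is the value of a Lagrange basis polynomial. -/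
theorem primIdem_eq_aeval_basis {F V : Type*} [Field F] [AddCommGroup V] [Module F V]
    (d : ℕ) (A : Module.End F V) (θ : ℕ → F) (i : ℕ) :
    primIdem d A θ i = aeval A (Lagrange.basis (range (d + 1)) θ i) := rfl

/-- A polynomial in `A` preserves every `A`-invariant subspace. -/
theorem aeval_mem_of_invariant {F V : Type*} [Field F] [AddCommGroup V] [Module F V]
    {A : Module.End F V} {W : Submodule F V} (hA : ∀ w ∈ W, A w ∈ W) (p : F[X])
    {w : V} (hw : w ∈ W) : aeval A p w ∈ W := by
  induction p using Polynomial.induction_on' with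
  | add p q hp hq => simpa using W.add_mem hp hq
  | monomial n a =>
    have hpow : (A ^ n) w ∈ W := by
      induction n with
      | zero => simpa using hw
      | succ n ih =>
        rw [pow_succ', Module.End.mul_apply]
        exact hA _ ih
    simpa [aeval_monomial, Algebra.algebraMap_eq_smul_one] using W.smul_mem a hpow

/-- An operator with `d + 1` distinct eigenvalues on a space of dimension `d + 1` has an
eigenbasis, in which the primitive idempotents are the coordinate projections. -/
theorem exists_eigenbasis {F V : Type*} [Field F] [AddCommGroup V] [Module F V]
    (d : ℕ) (hdim : Module.finrank F V = d + 1) (A : Module.End F V) (θ : ℕ → F)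
    (hinj : ∀ i ≤ d, ∀ j ≤ d, θ i = θ j → i = j)
    (heig : ∀ i ≤ d, Module.End.HasEigenvalue A (θ i)) :
    ∃ b : Basis (Fin (d + 1)) F V, ∀ (i : Fin (d + 1)) (v : V),
      primIdem d A θ i v = b.repr v i • b i := by
  choose x hx using fun i : Fin (d + 1) => (heig i (by omega)).exists_hasEigenvector
  have hli : LinearIndependent F x :=
    Module.End.eigenvectors_linearIndependent' A (fun i : Fin (d + 1) => θ i)
      (fun i j h => Fin.ext (hinj i (by omega) j (by omega) h)) x hx
  refine ⟨basisOfLinearIndependentOfCardEqFinrank hli (by simp [hdim]), fun i v => ?_⟩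
  set b := basisOfLinearIndependentOfCardEqFinrank hli (by simp [hdim]) with hb
  have hbx : ∀ j, b j = x j := fun j => by simp [hb]
  have hproj : ∀ j, primIdem d A θ i (b j) = if j = i then b j else 0 := by
    intro j
    rw [hbx, primIdem_eq_aeval_basis, Module.End.aeval_apply_of_hasEigenvector (hx j)]
    split_ifs with h
    · subst h
      rw [Lagrange.eval_basis_self (fun k hk l hl => hinj k (by simp at hk; omega) l
        (by simp at hl; omega)) (mem_range.2 j.2), one_smul]
    · rw [Lagrange.eval_basis_of_ne (fun hij => h (Fin.ext hij.symm)) (mem_range.2 j.2), zero_smul]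
  conv_lhs => rw [← b.sum_repr v, map_sum]
  simp only [map_smul, hproj, smul_ite, smul_zero]
  simp

/-- a nonzero subspace of `V` invariant under both `A` and `A*` of a
CH system equals `V`. -/
theorem stmt7 {F V : Type*} [Field F] [AddCommGroup V] [Module F V]
    (d : ℕ) (hd : 3 ≤ d) (hdim : Module.finrank F V = d + 1)
    (Φ : CHSystem F V d) (W : Submodule F V) (hW : W ≠ ⊥)
    (hAW : ∀ w ∈ W, Φ.A w ∈ W) (hAsW : ∀ w ∈ W, Φ.As w ∈ W) :
    W = ⊤ := by
  obtain ⟨b, hb⟩ := exists_eigenbasis d hdim Φ.A Φ.θ Φ.θ_inj Φ.A_eig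
  have hmem : ∀ (i : Fin (d + 1)) (w : V), w ∈ W → b.repr w i ≠ 0 → b i ∈ W := by
    intro i w hw hne
    have h : primIdem d Φ.A Φ.θ i w ∈ W := aeval_mem_of_invariant hAW _ hw
    rw [hb] at h
    exact (W.smul_mem_iff hne).1 h
  have hstep : ∀ i j : Fin (d + 1),
      primIdem d Φ.A Φ.θ i * Φ.As * primIdem d Φ.A Φ.θ j ≠ 0 → b j ∈ W → b i ∈ W := by
    intro i j hne hj
    obtain ⟨u, hu⟩ := DFunLike.ne_iff.1 hne
    simp only [Module.End.mul_apply, LinearMap.zero_apply] at hu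
    rw [hb j, hb i] at hu
    exact hmem i _ (hAsW _ (W.smul_mem _ hj)) (left_ne_zero_of_smul hu)
  obtain ⟨w, hw, hw0⟩ := W.ne_bot_iff.1 hW
  obtain ⟨k, hk⟩ : ∃ k, b.repr w k ≠ 0 := by
    by_contra! h
    exact hw0 (b.ext_elem fun i => by simp [h i])
  have hup : ∀ m (hm : m < d + 1), ∀ n (hn : n < d + 1), m ≤ n → b ⟨m, hm⟩ ∈ W →
      b ⟨n, hn⟩ ∈ W := by
    intro m hm n hn hmn h
    induction n, hmn using Nat.le_induction with
    | base => exact h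
    | succ n hmn ih =>
      exact hstep _ ⟨n, by omega⟩
        (Φ.circ₂ (n + 1) (by omega) n (by omega) (Or.inl (by simp))) (ih (by omega))
  have hlast : b ⟨d, by omega⟩ ∈ W := hup k k.2 d _ (by omega) (hmem k w hw hk)
  have hzero : b ⟨0, by omega⟩ ∈ W :=
    hstep _ ⟨d, by omega⟩ (Φ.circ₂ 0 (by omega) d le_rfl (Or.inr (by simp))) hlast
  rw [eq_top_iff, ← b.span_eq, Submodule.span_le]
  rintro _ ⟨i, rfl⟩
  exact hup 0 _ i i.2 (Nat.zero_le _) hzero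
end

section
/- Let Φ be a CH system on V with parameter array ({θ_i}_{i=0}^d, {θ*_i}_{i=0}^d, {φ_i}_{i=1}^d). Fix nonzero vectors u* ∈ E*_0V and u ∈ E_0V, and let ε, ε* ∈ F be the scalars with E_0 u* = ε u and E*_0 u = ε* u*. Then ε ε* = (φ_1 φ_2 ⋯ φ_d) / ((θ_0−θ_1)(θ_0−θ_2)⋯(θ_0−θ_d)(θ*_0−θ*_1)(θ*_0−θ*_2)⋯(θ*_0−θ*_d)). In particular ε and ε* are nonzero. -/
open Polynomial Finset Module

variable {F V : Type*} [Field F] [AddCommGroup V] [Module F V]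

/-- If `B` is bidiagonal on `w 0, …, w d` with diagonal entries `μ i` and superdiagonal entries
`c i`, the product of the first `n` factors of the idempotent of `μ 0` sends `w i` (for `i ≤ n`)
to an explicit multiple of `w 0`. -/
theorem aeval_prod_apply_of_bidiagonal
    {d : ℕ} {B : Module.End F V} {μ c : ℕ → F} {w : ℕ → V}
    (hμ : ∀ j, 1 ≤ j → j ≤ d → μ 0 ≠ μ j) (hw0 : B (w 0) = μ 0 • w 0)
    (hw : ∀ i < d, B (w (i + 1)) = μ (i + 1) • w (i + 1) + c (i + 1) • w i) :
    ∀ n ≤ d, ∀ i ≤ n,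
      Polynomial.aeval B (∏ j ∈ Finset.Icc 1 n,
        (Polynomial.C (μ 0 - μ j)⁻¹ * (Polynomial.X - Polynomial.C (μ j)))) (w i) =
      (∏ j ∈ Finset.Icc 1 i, (c j / (μ 0 - μ j))) • w 0 := by
  intro n
  induction n with
  | zero =>
    intro _ i hi
    obtain rfl : i = 0 := by omega
    simp
  | succ n ih =>
    intro hn i hi
    have hne : μ 0 - μ (n + 1) ≠ 0 := sub_ne_zero.mpr (hμ _ (by omega) hn)
    rw [Finset.prod_Icc_succ_top (by omega)]
    rcases Nat.lt_or_ge n i with h | h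
    · obtain rfl : i = n + 1 := by omega
      rw [map_mul, Module.End.mul_apply]
      have hfac : Polynomial.aeval B (Polynomial.C (μ 0 - μ (n + 1))⁻¹ *
          (Polynomial.X - Polynomial.C (μ (n + 1)))) (w (n + 1)) =
          (c (n + 1) / (μ 0 - μ (n + 1))) • w n := by
        simp [hw n (by omega), Module.algebraMap_end_apply, smul_smul, div_eq_mul_inv]
      rw [hfac, map_smul, ih (by omega) n le_rfl, smul_smul,
        Finset.prod_Icc_succ_top (by omega), mul_comm]
    · rw [mul_comm, map_mul, Module.End.mul_apply, ih (by omega) i h, map_smul]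
      congr 1
      simp [hw0, Module.algebraMap_end_apply, ← sub_smul, smul_smul, mul_inv_cancel₀ hne]

theorem primIdem_zero_apply_of_bidiagonal
    {d : ℕ} {B : Module.End F V} {μ c : ℕ → F} {w : ℕ → V}
    (hμ : ∀ j, 1 ≤ j → j ≤ d → μ 0 ≠ μ j) (hw0 : B (w 0) = μ 0 • w 0)
    (hw : ∀ i < d, B (w (i + 1)) = μ (i + 1) • w (i + 1) + c (i + 1) • w i)
    (i : ℕ) (hi : i ≤ d) :
    primIdem d B μ 0 (w i) = (∏ j ∈ Finset.Icc 1 i, (c j / (μ 0 - μ j))) • w 0 := by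
  have hset : (Finset.range (d + 1)).erase 0 = Finset.Icc 1 d := by
    ext j
    simp only [Finset.mem_erase, Finset.mem_range, Finset.mem_Icc]
    omega
  rw [primIdem, hset]
  exact aeval_prod_apply_of_bidiagonal hμ hw0 hw d le_rfl i hi

theorem exists_smul_eq_of_mem_range_primIdem_zero
    {d : ℕ} {B : Module.End F V} {μ c : ℕ → F} {w : ℕ → V}
    (hμ : ∀ j, 1 ≤ j → j ≤ d → μ 0 ≠ μ j) (hw0 : B (w 0) = μ 0 • w 0)
    (hw : ∀ i < d, B (w (i + 1)) = μ (i + 1) • w (i + 1) + c (i + 1) • w i)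
    (hspan : Submodule.span F (w '' Set.Iic d) = ⊤) {x : V}
    (hx : x ∈ LinearMap.range (primIdem d B μ 0)) : ∃ a : F, a • w 0 = x := by
  rw [← Submodule.mem_span_singleton]
  rw [LinearMap.range_eq_map, ← hspan, Submodule.map_span] at hx
  refine Submodule.span_le.mpr ?_ hx
  rintro _ ⟨_, ⟨i, hi, rfl⟩, rfl⟩
  rw [primIdem_zero_apply_of_bidiagonal hμ hw0 hw i hi]
  exact Submodule.smul_mem _ _ (Submodule.mem_span_singleton_self _)

/-- the formula for `ε ε*`; in particular `ε, ε*` are nonzero. -/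
theorem stmt10 {F V : Type*} [Field F] [AddCommGroup V] [Module F V]
    (d : ℕ) (hd : 3 ≤ d) (hdim : Module.finrank F V = d + 1)
    (Φ : CHSystem F V d) (φ : ℕ → F)
    (hφ0 : ∀ i, 1 ≤ i → i ≤ d → φ i ≠ 0)
    (hsplit : SplitSeq d Φ.A Φ.As Φ.θ Φ.θs φ)
    (ustar u : V) (hustar0 : ustar ≠ 0) (hu0 : u ≠ 0)
    (hustar : ustar ∈ LinearMap.range (primIdem d Φ.As Φ.θs 0))
    (hu : u ∈ LinearMap.range (primIdem d Φ.A Φ.θ 0))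
    (ε εs : F)
    (hε : primIdem d Φ.A Φ.θ 0 ustar = ε • u)
    (hεs : primIdem d Φ.As Φ.θs 0 u = εs • ustar) :
    ε * εs = (∏ i ∈ Finset.Icc 1 d, φ i) /
      ((∏ i ∈ Finset.Icc 1 d, (Φ.θ 0 - Φ.θ i)) * (∏ i ∈ Finset.Icc 1 d, (Φ.θs 0 - Φ.θs i)))
    ∧ ε ≠ 0 ∧ εs ≠ 0 := by
  obtain ⟨v, -, hspan, hA, hAd, hAs0, hAs⟩ := hsplit
  have hθ : ∀ j, 1 ≤ j → j ≤ d → Φ.θ 0 ≠ Φ.θ j := fun j h1 h2 h => by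
    have := Φ.θ_inj 0 (Nat.zero_le d) j h2 h
    omega
  have hθs : ∀ j, 1 ≤ j → j ≤ d → Φ.θs 0 ≠ Φ.θs j := fun j h1 h2 h => by
    have := Φ.θs_inj 0 (Nat.zero_le d) j h2 h
    omega
  have hAs' : ∀ i < d, Φ.As (v (i + 1)) = Φ.θs (i + 1) • v (i + 1) + φ (i + 1) • v i :=
    fun i hi => hAs (i + 1) (by omega) (by omega)
  -- Reversing the split basis puts `A` in the same bidiagonal form.
  let w : ℕ → V := fun i => v (d - i)
  have hw0 : Φ.A (w 0) = Φ.θ 0 • w 0 := hAd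
  have hw : ∀ i < d, Φ.A (w (i + 1)) = Φ.θ (i + 1) • w (i + 1) + (1 : F) • w i := by
    intro i hi
    have h := hA (d - (i + 1)) (by omega)
    rw [show d - (d - (i + 1)) = i + 1 by omega, show d - (i + 1) + 1 = d - i by omega] at h
    rw [one_smul]
    exact h
  have hwspan : Submodule.span F (w '' Set.Iic d) = ⊤ := by
    rw [← top_le_iff, ← hspan]
    refine Submodule.span_mono ?_
    rintro _ ⟨i, hi, rfl⟩
    refine ⟨d - i, Nat.sub_le d i, ?_⟩
    change v (d - (d - i)) = v i
    rw [Nat.sub_sub_self hi]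
  obtain ⟨a, rfl⟩ := exists_smul_eq_of_mem_range_primIdem_zero hθs hAs0 hAs' hspan hustar
  obtain ⟨b, rfl⟩ := exists_smul_eq_of_mem_range_primIdem_zero (c := fun _ => 1)
    hθ hw0 hw hwspan hu
  have ha : a ≠ 0 := left_ne_zero_of_smul hustar0
  have hb : b ≠ 0 := left_ne_zero_of_smul hu0
  have hv0 : v 0 ≠ 0 := right_ne_zero_of_smul hustar0
  have hvd : w 0 ≠ 0 := right_ne_zero_of_smul hu0
  have hEs : primIdem d Φ.As Φ.θs 0 (w 0) = _ :=
    primIdem_zero_apply_of_bidiagonal hθs hAs0 hAs' d le_rfl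
  have hE := primIdem_zero_apply_of_bidiagonal (c := fun _ => 1) hθ hw0 hw d le_rfl
  rw [show w d = v 0 from congrArg v (Nat.sub_self d)] at hE
  rw [map_smul, hE, smul_smul, smul_smul] at hε
  rw [map_smul, hEs, smul_smul, smul_smul] at hεs
  have h1 := smul_left_injective F hvd hε
  have h2 := smul_left_injective F hv0 hεs
  simp only [Finset.prod_div_distrib, Finset.prod_const_one] at h1 h2
  have hP : ∏ i ∈ Finset.Icc 1 d, φ i ≠ 0 := Finset.prod_ne_zero_iff.mpr fun i hi =>
    hφ0 i (Finset.mem_Icc.mp hi).1 (Finset.mem_Icc.mp hi).2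
  have hQ : ∏ i ∈ Finset.Icc 1 d, (Φ.θ 0 - Φ.θ i) ≠ 0 := Finset.prod_ne_zero_iff.mpr fun i hi =>
    sub_ne_zero.mpr (hθ i (Finset.mem_Icc.mp hi).1 (Finset.mem_Icc.mp hi).2)
  have hR : ∏ i ∈ Finset.Icc 1 d, (Φ.θs 0 - Φ.θs i) ≠ 0 := Finset.prod_ne_zero_iff.mpr fun i hi =>
    sub_ne_zero.mpr (hθs i (Finset.mem_Icc.mp hi).1 (Finset.mem_Icc.mp hi).2)
  have key : ε * εs = (∏ i ∈ Finset.Icc 1 d, φ i) /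
      ((∏ i ∈ Finset.Icc 1 d, (Φ.θ 0 - Φ.θ i)) *
        (∏ i ∈ Finset.Icc 1 d, (Φ.θs 0 - Φ.θs i))) := by
    rw [← div_eq_iff hb] at h1
    rw [← div_eq_iff ha] at h2
    rw [← h1, ← h2]
    field_simp
  have hne : ε * εs ≠ 0 := key ▸ div_ne_zero hP (mul_ne_zero hQ hR)
  exact ⟨key, left_ne_zero_of_mul hne, right_ne_zero_of_mul hne⟩
end

section
/- Let Φ be a CH system on V with parameter array ({θ_i}_{i=0}^d, {θ*_i}_{i=0}^d, {φ_i}_{i=1}^d). Fix nonzero vectors u* ∈ E*_0V and u ∈ E_0V, and let ε, ε* ∈ F be the scalars with E_0 u* = ε u and E*_0 u = ε* u*. Define v_i = (A − θ_{d−i+1}I)⋯(A − θ_{d−1}I)(A − θ_dI)u* and v*_i = (A* − θ*_{d−i+1}I)⋯(A* − θ*_{d−1}I)(A* − θ*_dI)u for 0 ≤ i ≤ d. Then: (i) v_i = ε · ((θ_0−θ_1)(θ_0−θ_2)⋯(θ_0−θ_d) / (φ_{i+1}φ_{i+2}⋯φ_d)) · v*_{d−i} for 0 ≤ i ≤ d;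 and (ii) v*_i = ε* · ((θ*_0−θ*_1)(θ*_0−θ*_2)⋯(θ*_0−θ*_d) / (φ_1φ_2⋯φ_{d−i})) · v_{d−i} for 0 ≤ i ≤ d (empty products equal 1). -/
open Polynomial Finset Module

variable {F V : Type*} [Field F] [AddCommGroup V] [Module F V]

/-- The primitive idempotent of index `0` is a normalized product of linear factors. -/
theorem prod_smul_primIdem_zero {F V : Type*} [Field F] [AddCommGroup V] [Module F V]
    (d : ℕ) (A : Module.End F V) (θ : ℕ → F) (h : ∀ i ≤ d, ∀ j ≤ d, θ i = θ j → i = j) :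
    (∏ k ∈ Finset.Icc 1 d, (θ 0 - θ k)) • primIdem d A θ 0 =
      aeval A (∏ k ∈ Finset.Icc 1 d, (X - C (θ k))) := by
  have hset : (Finset.range (d + 1)).erase 0 = Finset.Icc 1 d := by
    ext k
    simp only [Finset.mem_erase, Finset.mem_range, Finset.mem_Icc]
    omega
  have hne : ∏ k ∈ Finset.Icc 1 d, (θ 0 - θ k) ≠ 0 := by
    refine Finset.prod_ne_zero_iff.2 fun k hk => sub_ne_zero.2 fun hθ => ?_
    rw [Finset.mem_Icc] at hk
    have := h 0 (Nat.zero_le d) k hk.2 hθ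
    omega
  rw [primIdem, hset, Finset.prod_mul_distrib, ← map_prod, ← Polynomial.smul_eq_C_mul, map_smul,
    smul_smul, Finset.prod_inv_distrib, mul_inv_cancel₀ hne, one_smul]

/-- Applying one more linear factor at the lower end of the product. -/
theorem aeval_prod_Icc_succ {F V : Type*} [Field F] [AddCommGroup V] [Module F V]
    (d : ℕ) (A : Module.End F V) (θ : ℕ → F) (x : V) {i : ℕ} (hi : i < d) :
    aeval A (∏ k ∈ Finset.Icc (d - (i + 1) + 1) d, (X - C (θ k))) x =
      A (aeval A (∏ k ∈ Finset.Icc (d - i + 1) d, (X - C (θ k))) x) -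
        θ (d - i) • aeval A (∏ k ∈ Finset.Icc (d - i + 1) d, (X - C (θ k))) x := by
  have hd : d - (i + 1) + 1 = d - i := by omega
  rw [hd, ← Finset.insert_Icc_add_one_left_eq_Icc (Nat.sub_le d i), Finset.prod_insert (by simp),
    map_mul, Module.End.mul_apply]
  simp [Algebra.algebraMap_eq_smul_one]

/-- If `B` acts on `w 0, …, w d` in an upper bidiagonal way, then the product of the factors
`B - θ k` with `1 ≤ k ≤ n` maps each `w j` with `j ≤ n` to a multiple of `w 0`. -/
theorem aeval_prod_Icc_mem_span {F V : Type*} [Field F] [AddCommGroup V] [Module F V]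
    (d : ℕ) (B : Module.End F V) (θ φ : ℕ → F) (w : ℕ → V) (h0 : B (w 0) = θ 0 • w 0)
    (h : ∀ i, 1 ≤ i → i ≤ d → B (w i) = θ i • w i + φ i • w (i - 1)) {n : ℕ} (hn : n ≤ d)
    {j : ℕ} (hj : j ≤ n) :
    aeval B (∏ k ∈ Finset.Icc 1 n, (X - C (θ k))) (w j) ∈ Submodule.span F {w 0} := by
  induction n generalizing j with
  | zero =>
    obtain rfl : j = 0 := by omega
    simp
  | succ n ih =>
    rw [Finset.prod_Icc_succ_top (by omega), map_mul, Module.End.mul_apply]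
    have hstep : aeval B (X - C (θ (n + 1))) (w j) = B (w j) - θ (n + 1) • w j := by
      simp [Algebra.algebraMap_eq_smul_one]
    rw [hstep]
    obtain rfl | hpos := Nat.eq_zero_or_pos j
    · rw [h0, ← sub_smul, map_smul]
      exact Submodule.smul_mem _ _ (ih (by omega) (Nat.zero_le n))
    · rw [h j hpos (hj.trans hn)]
      have hpred := ih (by omega) (j := j - 1) (by omega)
      obtain rfl | hlt := hj.eq_or_lt
      · rw [add_sub_cancel_left, map_smul]
        exact Submodule.smul_mem _ _ hpred
      · rw [map_sub, map_add, map_smul, map_smul, map_smul]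
        have hself := ih (by omega) (j := j) (by omega)
        exact Submodule.sub_mem _ (Submodule.add_mem _ (Submodule.smul_mem _ _ hself)
          (Submodule.smul_mem _ _ hpred)) (Submodule.smul_mem _ _ hself)

/-- The eigenspace attached to the index `0` is spanned by the first vector of a split basis. -/
theorem mem_span_of_mem_range_primIdem_zero {F V : Type*} [Field F] [AddCommGroup V] [Module F V]
    (d : ℕ) (B : Module.End F V) (θ φ : ℕ → F) (hθ : ∀ i ≤ d, ∀ j ≤ d, θ i = θ j → i = j)
    (w : ℕ → V) (hw : Submodule.span F (w '' Set.Iic d) = ⊤) (h0 : B (w 0) = θ 0 • w 0)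
    (h : ∀ i, 1 ≤ i → i ≤ d → B (w i) = θ i • w i + φ i • w (i - 1)) {x : V}
    (hx : x ∈ LinearMap.range (primIdem d B θ 0)) :
    x ∈ Submodule.span F {w 0} := by
  obtain ⟨y, rfl⟩ := hx
  have hle : Submodule.span F (w '' Set.Iic d) ≤ (Submodule.span F {w 0}).comap
      (aeval B (∏ k ∈ Finset.Icc 1 d, (X - C (θ k)))) := by
    rw [Submodule.span_le]
    rintro _ ⟨j, hj, rfl⟩
    exact aeval_prod_Icc_mem_span d B θ φ w h0 h le_rfl hj
  rw [hw] at hle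
  have hy := hle (Submodule.mem_top (x := y))
  rw [Submodule.mem_comap, ← prod_smul_primIdem_zero d B θ hθ, LinearMap.smul_apply] at hy
  refine (Submodule.smul_mem_iff _ (Finset.prod_ne_zero_iff.2 fun k hk => sub_ne_zero.2
    fun hk0 => ?_)).1 hy
  rw [Finset.mem_Icc] at hk
  have := hθ 0 (Nat.zero_le d) k hk.2 hk0
  omega

/-- relation between the split basis `{v i}` and the dual split basis `{v* i}`. -/
theorem stmt11 {F V : Type*} [Field F] [AddCommGroup V] [Module F V]
    (d : ℕ) (hd : 3 ≤ d) (hdim : Module.finrank F V = d + 1)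
    (Φ : CHSystem F V d) (φ : ℕ → F)
    (hφ0 : ∀ i, 1 ≤ i → i ≤ d → φ i ≠ 0)
    (hsplit : SplitSeq d Φ.A Φ.As Φ.θ Φ.θs φ)
    (ustar u : V) (hustar0 : ustar ≠ 0) (hu0 : u ≠ 0)
    (hustar : ustar ∈ LinearMap.range (primIdem d Φ.As Φ.θs 0))
    (hu : u ∈ LinearMap.range (primIdem d Φ.A Φ.θ 0))
    (ε εs : F)
    (hε : primIdem d Φ.A Φ.θ 0 ustar = ε • u)
    (hεs : primIdem d Φ.As Φ.θs 0 u = εs • ustar)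
    (v vs : ℕ → V)
    (hv : ∀ i ≤ d, v i = Polynomial.aeval Φ.A
      (∏ k ∈ Finset.Icc (d - i + 1) d, (Polynomial.X - Polynomial.C (Φ.θ k))) ustar)
    (hvs : ∀ i ≤ d, vs i = Polynomial.aeval Φ.As
      (∏ k ∈ Finset.Icc (d - i + 1) d, (Polynomial.X - Polynomial.C (Φ.θs k))) u) :
    (∀ i ≤ d, v i =
      (ε * (∏ k ∈ Finset.Icc 1 d, (Φ.θ 0 - Φ.θ k)) / (∏ k ∈ Finset.Icc (i+1) d, φ k)) •
        vs (d - i)) ∧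
    (∀ i ≤ d, vs i =
      (εs * (∏ k ∈ Finset.Icc 1 d, (Φ.θs 0 - Φ.θs k)) / (∏ k ∈ Finset.Icc 1 (d - i), φ k)) •
        v (d - i)) := by
  obtain ⟨w, -, hspan, hA, -, hB0, hB⟩ := hsplit
  obtain ⟨c, hc⟩ := Submodule.mem_span_singleton.1
    (mem_span_of_mem_range_primIdem_zero d Φ.As Φ.θs φ Φ.θs_inj w hspan hB0 hB hustar)
  have hv0 : v 0 = ustar := by simp [hv 0 (Nat.zero_le d)]
  have hvs0 : vs 0 = u := by simp [hvs 0 (Nat.zero_le d)]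
  have hvw : ∀ i ≤ d, v i = c • w i := by
    intro i
    induction i with
    | zero => exact fun _ => hv0.trans hc.symm
    | succ i ih =>
      intro hi
      rw [hv _ hi, aeval_prod_Icc_succ d _ _ _ hi, ← hv i (by omega), ih (by omega), map_smul,
        hA i hi]
      module
  have hvsucc : ∀ i < d, Φ.As (v (i + 1)) - Φ.θs (i + 1) • v (i + 1) = φ (i + 1) • v i := by
    intro i hi
    rw [hvw (i + 1) hi, hvw i hi.le, map_smul, hB (i + 1) (by omega) hi, Nat.add_sub_cancel]
    module
  have hvd : v d = (ε * ∏ k ∈ Finset.Icc 1 d, (Φ.θ 0 - Φ.θ k)) • u := by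
    rw [hv d le_rfl, Nat.sub_self, zero_add, ← prod_smul_primIdem_zero d _ _ Φ.θ_inj,
      LinearMap.smul_apply, hε, smul_smul, mul_comm]
  have hvsd : vs d = (εs * ∏ k ∈ Finset.Icc 1 d, (Φ.θs 0 - Φ.θs k)) • ustar := by
    rw [hvs d le_rfl, Nat.sub_self, zero_add, ← prod_smul_primIdem_zero d _ _ Φ.θs_inj,
      LinearMap.smul_apply, hεs, smul_smul, mul_comm]
  set K := ε * ∏ k ∈ Finset.Icc 1 d, (Φ.θ 0 - Φ.θ k)
  set Ks := εs * ∏ k ∈ Finset.Icc 1 d, (Φ.θs 0 - Φ.θs k)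
  have hfst : ∀ i ≤ d, v i = (K / ∏ k ∈ Finset.Icc (i + 1) d, φ k) • vs (d - i) := by
    intro i hi
    induction hi using Nat.decreasingInduction with
    | self => simp [hvd, hvs0]
    | of_succ i hi ih =>
      have hφ := hφ0 (i + 1) (by omega) hi
      have hstep := aeval_prod_Icc_succ d Φ.As Φ.θs u (i := d - (i + 1)) (by omega)
      rw [← hvs _ (by omega), ← hvs _ (by omega), show d - (i + 1) + 1 = d - i by omega,
        show d - (d - (i + 1)) = i + 1 by omega] at hstep
      rw [← Finset.insert_Icc_add_one_left_eq_Icc (Nat.succ_le_of_lt hi),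
        Finset.prod_insert (by simp), hstep, ← inv_smul_smul₀ hφ (v i), ← hvsucc i hi, ih,
        map_smul, smul_comm (Φ.θs (i + 1)), ← smul_sub, smul_smul]
      congr 1
      rw [div_mul_eq_div_div_swap, div_eq_inv_mul _ (φ (i + 1))]
  refine ⟨hfst, fun i hi => ?_⟩
  have hprod : ∀ m n, 1 ≤ m → n ≤ d → ∏ k ∈ Finset.Icc m n, φ k ≠ 0 := fun m n hm hn =>
    Finset.prod_ne_zero_iff.2 fun k hk => by
      rw [Finset.mem_Icc] at hk
      exact hφ0 k (hm.trans hk.1) (hk.2.trans hn)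
  have hKK : K * Ks = ∏ k ∈ Finset.Icc 1 d, φ k := by
    have h := hfst 0 (Nat.zero_le d)
    rw [Nat.sub_zero, zero_add, hvsd, hv0, smul_smul] at h
    have h1 := smul_left_injective F hustar0 ((one_smul F ustar).trans h)
    have := hprod 1 d le_rfl le_rfl
    field_simp at h1
    exact h1.symm
  have hsplit_prod : (∏ k ∈ Finset.Icc 1 (d - i), φ k) * ∏ k ∈ Finset.Icc (d - i + 1) d, φ k =
      ∏ k ∈ Finset.Icc 1 d, φ k := by
    have h := Finset.prod_Ioc_consecutive φ (Nat.zero_le (d - i)) (Nat.sub_le d i)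
    simpa only [← Finset.Icc_add_one_left_eq_Ioc, zero_add] using h
  have h1 := hprod 1 (d - i) le_rfl (Nat.sub_le d i)
  have h2 := hprod (d - i + 1) d (by omega) le_rfl
  rw [hfst (d - i) (Nat.sub_le d i), Nat.sub_sub_self hi, smul_smul, div_mul_div_comm, hsplit_prod,
    mul_comm Ks K, hKK, div_self (hprod 1 d le_rfl le_rfl), one_smul]
end

section
/- Let Φ = (A; {E_i}_{i=0}^d; A*; {E*_i}_{i=0}^d) be a CH system on V with eigenvalue sequence {θ_i}_{i=0}^d and dual eigenvalue sequence {θ*_i}_{i=0}^d. Let {u_i}_{i=0}^d be a basis of V, and let B (resp. B*) denote the matrix representing A (resp. A*) with respect to this basis (so A u_j = ∑_i B_{ij} u_i). Then there exists a nonzero u* ∈ E*_0V with u_i = E_i u* for 0 ≤ i ≤ d if and only if both: (i) B = diag(θ_0, θ_1, …, θ_d), and (ii) B* has constant row sum θ*_0, i.e., ∑_{j=0}^d B*_{ij} = θ*_0 for 0 ≤ i ≤ d. -/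
open Polynomial Finset Module

variable {F V : Type*} [Field F] [AddCommGroup V] [Module F V]

/-- If the product of all `A - θ j` vanishes, then `primIdem d A θ i` maps into the
`θ i`-eigenspace of `A`. -/
theorem apply_primIdem_apply {d : ℕ} {A : Module.End F V} {θ : ℕ → F} {i : ℕ} (hi : i ≤ d)
    (hann : Polynomial.aeval A (∏ j ∈ Finset.range (d+1), (Polynomial.X - Polynomial.C (θ j))) = 0)
    (v : V) : A (primIdem d A θ i v) = θ i • primIdem d A θ i v := by
  have hpoly : (X - C (θ i)) * ∏ j ∈ (Finset.range (d+1)).erase i,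
      (C (θ i - θ j)⁻¹ * (X - C (θ j))) =
      (∏ j ∈ (Finset.range (d+1)).erase i, C (θ i - θ j)⁻¹) *
        ∏ j ∈ Finset.range (d+1), (X - C (θ j)) := by
    rw [Finset.prod_mul_distrib, ← Finset.mul_prod_erase (Finset.range (d+1)) _
      (Finset.mem_range.2 (Nat.lt_succ_of_le hi))]
    ring
  have h := congrArg (fun p => Polynomial.aeval A p v) hpoly
  simp only [map_mul (Polynomial.aeval A), hann, mul_zero, LinearMap.zero_apply] at h
  simpa [primIdem, sub_eq_zero] using h

/-- `primIdem d A θ i` acts on a `θ j`-eigenvector of `A` as the Kronecker delta. -/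
theorem primIdem_apply_of_apply_eq_smul {d : ℕ} {A : Module.End F V} {θ : ℕ → F}
    (hinj : ∀ i ≤ d, ∀ j ≤ d, θ i = θ j → i = j) {i j : ℕ} (hi : i ≤ d) (hj : j ≤ d)
    {v : V} (hv : A v = θ j • v) :
    primIdem d A θ i v = if i = j then v else 0 := by
  rcases eq_or_ne v 0 with rfl | hv0
  · simp
  rw [primIdem, Module.End.aeval_apply_of_hasEigenvector
    ⟨Module.End.mem_eigenspace_iff.2 hv, hv0⟩, Polynomial.eval_prod]
  split_ifs with hij
  · subst hij
    rw [Finset.prod_eq_one, one_smul]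
    intro k hk
    obtain ⟨hki, hk⟩ := Finset.mem_erase.1 hk
    have : θ i - θ k ≠ 0 := fun h =>
      hki (hinj i hi k (Nat.lt_succ_iff.1 (Finset.mem_range.1 hk)) (sub_eq_zero.1 h)).symm
    simp [this]
  · rw [Finset.prod_eq_zero (i := j), zero_smul]
    · exact Finset.mem_erase.2 ⟨Ne.symm hij, Finset.mem_range.2 (Nat.lt_succ_of_le hj)⟩
    · simp

/-- The matrix of `A` with respect to `b` is diagonal iff `b` consists of eigenvectors. -/
theorem toMatrix_eq_diagonal_iff {ι : Type*} [Fintype ι] [DecidableEq ι] (b : Basis ι F V)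
    (A : Module.End F V) (μ : ι → F) :
    LinearMap.toMatrix b b A = Matrix.diagonal μ ↔ ∀ i, A (b i) = μ i • b i := by
  constructor
  · intro h i
    refine b.ext_elem fun k => ?_
    rw [← LinearMap.toMatrix_apply, h]
    simp [Matrix.diagonal_apply, Finsupp.single_apply, eq_comm]
    grind
  · intro h
    ext k i
    rw [LinearMap.toMatrix_apply, h]
    simp [Matrix.diagonal_apply, Finsupp.single_apply]
    grind

/-- The matrix of `A` with respect to `b` has constant row sum `μ` iff the sum of the basis
vectors satisfies the eigenvalue equation for `μ`. -/
theorem toMatrix_row_sum_eq_iff {ι : Type*} [Fintype ι] [DecidableEq ι] (b : Basis ι F V)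
    (A : Module.End F V) (μ : F) :
    (∀ i, ∑ j, LinearMap.toMatrix b b A i j = μ) ↔ A (∑ j, b j) = μ • ∑ j, b j := by
  rw [← b.repr.injective.eq_iff, DFunLike.ext_iff]
  simp [LinearMap.toMatrix_apply, Finsupp.single_apply]

/-- matrix characterization of the `Φ`-standard basis. -/
theorem stmt13 {F V : Type*} [Field F] [AddCommGroup V] [Module F V]
    (d : ℕ) (hd : 3 ≤ d) (hdim : Module.finrank F V = d + 1)
    (Φ : CHSystem F V d)
    (b : Basis (Fin (d+1)) F V)
    (B Bs : Matrix (Fin (d+1)) (Fin (d+1)) F)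
    (hB : B = LinearMap.toMatrix b b Φ.A)
    (hBs : Bs = LinearMap.toMatrix b b Φ.As) :
    (∃ ustar : V, ustar ≠ 0 ∧ ustar ∈ LinearMap.range (primIdem d Φ.As Φ.θs 0) ∧
      ∀ i : Fin (d+1), b i = primIdem d Φ.A Φ.θ (i : ℕ) ustar) ↔
    (B = Matrix.diagonal (fun i : Fin (d+1) => Φ.θ (i : ℕ)) ∧
      ∀ i : Fin (d+1), ∑ j : Fin (d+1), Bs i j = Φ.θs 0) := by
  subst hB hBs
  rw [toMatrix_eq_diagonal_iff, toMatrix_row_sum_eq_iff]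
  have hle (i : Fin (d+1)) : (i : ℕ) ≤ d := Nat.lt_succ_iff.1 i.2
  have hidem (hA : ∀ j : Fin (d+1), Φ.A (b j) = Φ.θ j • b j) (c : Fin (d+1) → F)
      (i : Fin (d+1)) : primIdem d Φ.A Φ.θ i (∑ j, c j • b j) = c i • b i := by
    simp [primIdem_apply_of_apply_eq_smul Φ.θ_inj (hle i) (hle _) (hA _), Fin.val_inj]
  constructor
  · rintro ⟨u, -, ⟨w, rfl⟩, hbu⟩
    have hA (i : Fin (d+1)) : Φ.A (b i) = Φ.θ i • b i := by
      rw [hbu i]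
      exact apply_primIdem_apply (hle i) Φ.A_ann _
    refine ⟨hA, ?_⟩
    set u := primIdem d Φ.As Φ.θs 0 w with hu
    have hcoeff (i : Fin (d+1)) : b.repr u i = 1 := by
      have h := hidem hA (b.repr u) i
      rw [b.sum_repr, ← hbu i] at h
      exact (by simpa using congrArg (fun v => b.repr v i) h : (1 : F) = b.repr u i).symm
    have hsum : ∑ j, b j = u := by
      conv_rhs => rw [← b.sum_repr u]
      simp [hcoeff]
    rw [hsum]
    exact apply_primIdem_apply d.zero_le Φ.As_ann w
  · rintro ⟨hA, hAs⟩
    refine ⟨∑ j, b j, fun h => ?_, ⟨∑ j, b j, ?_⟩, fun i => ?_⟩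
    · simpa [Finsupp.single_apply] using congrArg (fun v => b.repr v 0) h
    · simp [primIdem_apply_of_apply_eq_smul Φ.θs_inj d.zero_le d.zero_le hAs]
    · simpa using (hidem hA 1 i).symm
end
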